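/- Let (R, m) be a Noetherian local ring and M a finitely generated R-module with canonical module ω_M. Then for every ideal a of R one has ht_{ω_M}(a) ≥ ht_M(a), and for every prime p ∈ Supp_R(ω_M) equality ht_{ω_M}(p) = ht_M(p) holds. -/

import Mathlib

open CategoryTheory IsLocalRing Pointwise

noncomputable section

/-- `E` is an injective hull of `S ⧸ J` over `S`. -/
def IsInjHull (S : Type) [CommRing S] (J : Ideal S) (E : Type) [AddCommGroup E]
    [Module S E] : Prop :=
  Module.Injective S E ∧
    ∃ f : (S ⧸ J) →ₗ[S] E, Function.Injective f ∧
      ∀ N : Submodule S E, N ≠ ⊥ → N ⊓ LinearMap.range f ≠ ⊥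

/-- Local cohomology `H^i_J(M)`. -/
abbrev LC (S : Type) [CommRing S] (J : Ideal S) (i : ℕ) (M : ModuleCat S) : ModuleCat S :=
  (localCohomology J i).obj M

/-- Krull dimension of a module (dimension of its support). -/
def mdim (S : Type) [CommRing S] (M : Type) [AddCommGroup M] [Module S M] : WithBot ℕ∞ :=
  Order.krullDim (Module.support S M)

/-- Depth/grade of an ideal `J` on `M`: supremum of lengths of `M`-regular sequences in `J`. -/
def gradeI (S : Type) [CommRing S] (J : Ideal S) (M : Type) [AddCommGroup M]
    [Module S M] : ℕ∞ :=
  sSup {n : ℕ∞ | ∃ rs : List S, (rs.length : ℕ∞) = n ∧ (∀ r ∈ rs, r ∈ J) ∧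
    RingTheory.Sequence.IsRegular M rs}

/-- The local "height" of `M` at a prime `p`, i.e. `dim_{S_p} M_p`. -/
def htM (S : Type) [CommRing S] (M : Type) [AddCommGroup M] [Module S M]
    (p : PrimeSpectrum S) : WithBot ℕ∞ :=
  mdim (Localization.AtPrime p.asIdeal) (LocalizedModule p.asIdeal.primeCompl M)

/-- `ht_M(a) = inf { dim_{S_p} M_p : p ⊇ a, p ∈ Supp M }`. -/
def htI (S : Type) [CommRing S] (M : Type) [AddCommGroup M] [Module S M]
    (a : Ideal S) : WithBot ℕ∞ :=
  sInf {d | ∃ p ∈ Module.support S M, a ≤ p.asIdeal ∧ d = htM S M p}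

/-- Serre's condition `S_n` for the module `M`. -/
def Serre (S : Type) [CommRing S] (n : ℕ) (M : Type) [AddCommGroup M] [Module S M] : Prop :=
  ∀ (p : Ideal S) [p.IsPrime],
    min (n : WithBot ℕ∞)
        (mdim (Localization.AtPrime p) (LocalizedModule p.primeCompl M)) ≤
      (gradeI (Localization.AtPrime p) (IsLocalRing.maximalIdeal (Localization.AtPrime p))
        (LocalizedModule p.primeCompl M) : ℕ∞)

/-- Attached primes of `M` (Macdonald): primes of the form `Ann(M ⧸ N)`. -/
def attachedPrimes (S : Type) [CommRing S] (M : Type) [AddCommGroup M] [Module S M] :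
    Set (Ideal S) :=
  {p | p.IsPrime ∧ ∃ N : Submodule S M, p = Module.annihilator S (M ⧸ N)}

/-- `ω` is a canonical module of the `d`-dimensional module `M` over `(S, J)`:
its "Matlis dual" `Hom_S(ω, E)` is isomorphic to `H^d_J(M)`. -/
def IsCanonicalModule (S : Type) [CommRing S] (J : Ideal S) (d : ℕ)
    (M ω : ModuleCat S) : Prop :=
  Module.Finite S ω ∧ ∃ E : ModuleCat S, IsInjHull S J ↥E ∧
    Nonempty ((↥ω →ₗ[S] ↥E) ≃ₗ[S] ↥(LC S J d M))

/-- `(S, J)` is quasi-Gorenstein: `H^d_J(S)` is an injective hull of `S ⧸ J`, `d = dim S`. -/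
def IsQuasiGorensteinAt (S : Type) [CommRing S] (J : Ideal S) : Prop :=
  ∃ d : ℕ, ringKrullDim S = (d : WithBot ℕ∞) ∧
    ∃ E : ModuleCat S, IsInjHull S J ↥E ∧
      Nonempty (↥(LC S J d (ModuleCat.of S S)) ≃ₗ[S] ↥E)

/-- Totally reflexive modules. -/
def TotallyReflexive (S : Type) [CommRing S] (M : ModuleCat S) : Prop :=
  Module.Finite S ↥M ∧ Module.IsReflexive S ↥M ∧
    ∀ i : ℕ, 0 < i →
      Subsingleton ↥(((Ext S (ModuleCat S) i).obj (Opposite.op M)).obj (ModuleCat.of S S)) ∧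
      Subsingleton ↥(((Ext S (ModuleCat S) i).obj
        (Opposite.op (ModuleCat.of S (Module.Dual S ↥M)))).obj (ModuleCat.of S S))

/-- `G`-dimension at most `n`. -/
def GdimLE (S : Type) [CommRing S] : ℕ → ModuleCat S → Prop
  | 0, M => TotallyReflexive S M
  | n + 1, M => ∃ (G : ModuleCat S) (f : ↥G →ₗ[S] ↥M), Function.Surjective f ∧
      TotallyReflexive S G ∧ GdimLE S n (ModuleCat.of S (LinearMap.ker f))

/-- Injective dimension at most `n`. -/
def InjDimLE (S : Type) [CommRing S] : ℕ → ModuleCat S → Prop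
  | 0, M => Module.Injective S ↥M
  | n + 1, M => ∃ (E : ModuleCat S) (f : ↥M →ₗ[S] ↥E), Function.Injective f ∧
      Module.Injective S ↥E ∧ InjDimLE S n (ModuleCat.of S (↥E ⧸ LinearMap.range f))

/-- Injective dimension, as an element of `ℕ∞`. -/
def injDim (S : Type) [CommRing S] (M : ModuleCat S) : ℕ∞ :=
  sInf {n : ℕ∞ | ∃ k : ℕ, (k : ℕ∞) = n ∧ InjDimLE S k M}

/-- Minimal number of generators. -/
def genNumber (S : Type) [CommRing S] (M : Type) [AddCommGroup M] [Module S M] : ℕ∞ :=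
  sInf {n : ℕ∞ | ∃ s : Finset M, (s.card : ℕ∞) = n ∧ Submodule.span S (↑s : Set M) = ⊤}

/-- The socle `0 :_M J`. -/
def socle (S : Type) [CommRing S] (J : Ideal S) (M : Type) [AddCommGroup M] [Module S M] :
    Submodule S M :=
  ⨅ r ∈ J, LinearMap.ker (LinearMap.lsmul S M r)

/-- Limit closure of the sequence `x` on `M`. -/
def limClo (S : Type) [CommRing S] {v : ℕ} (x : Fin v → S) (M : Type) [AddCommGroup M]
    [Module S M] : Submodule S M :=
  ⨆ t : ℕ, (Ideal.span (Set.range fun i => x i ^ (t + 1)) • (⊤ : Submodule S M)).comap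
      (LinearMap.lsmul S M ((∏ i, x i) ^ t))

end

/-- Krull dimension of a ring, valued in `WithBot ℕ∞`. -/
noncomputable def rdim (S : Type) [CommRing S] : WithBot ℕ∞ :=
  Order.krullDim (PrimeSpectrum S)

section ExtCocycles

open Limits Opposite

universe u

variable {R : Type u} [CommRing R]

/-- The complex computing `Ext` from the chosen projective resolution of `X`. -/
noncomputable abbrev extComplex (X Y : ModuleCat.{u} R) : ChainComplex (ModuleCat.{u} R)ᵒᵖ ℕ :=
  (((linearYoneda R (ModuleCat.{u} R)).obj Y).rightOp.mapHomologicalComplex _).obj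
    (projectiveResolution X).complex

/-- The cocycles in degree `n` of `Hom(P, Y)`, for `P` the chosen projective resolution of `X`. -/
noncomputable abbrev ExtCyc (X Y : ModuleCat.{u} R) (n : ℕ) : ModuleCat.{u} R :=
  ((extComplex X Y).opcycles n).unop

/-- The map underlying a cocycle. -/
noncomputable def extVal {X Y : ModuleCat.{u} R} {n : ℕ} :
    ExtCyc X Y n →ₗ[R] ((projectiveResolution X).complex.X n ⟶ Y) :=
  ((extComplex X Y).pOpcycles n).unop.hom

/-- The class of a cocycle. -/
noncomputable def extMk {X Y : ModuleCat.{u} R} {n : ℕ} :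
    ExtCyc X Y n →ₗ[R] ((Ext R (ModuleCat.{u} R) n).obj (op X)).obj Y :=
  (((extComplex X Y).homologyι n).unop ≫ ((projectiveResolution X).isoLeftDerivedObj
    ((linearYoneda R (ModuleCat.{u} R)).obj Y).rightOp n).hom.unop).hom

lemma extVal_injective {X Y : ModuleCat.{u} R} {n : ℕ} :
    Function.Injective (extVal (X := X) (Y := Y) (n := n)) :=
  (ModuleCat.mono_iff_injective ((extComplex X Y).pOpcycles n).unop).1 inferInstance

lemma extMk_surjective {X Y : ModuleCat.{u} R} {n : ℕ} :
    Function.Surjective (extMk (X := X) (Y := Y) (n := n)) := by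
  have h : Function.Surjective ((projectiveResolution X).isoLeftDerivedObj
    ((linearYoneda R (ModuleCat.{u} R)).obj Y).rightOp n).hom.unop.hom :=
    (ModuleCat.epi_iff_surjective _).1 inferInstance
  exact h.comp ((ModuleCat.epi_iff_surjective ((extComplex X Y).homologyι n).unop).1 inferInstance)

lemma d_extVal {X Y : ModuleCat.{u} R} {n : ℕ} (z : ExtCyc X Y n) :
    (projectiveResolution X).complex.d (n + 1) n ≫ extVal z = 0 := by
  have := (extComplex X Y).d_pOpcycles (n + 1) n
  exact congrArg (fun f ↦ f.unop.hom z) this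

lemma exists_extVal_eq {X Y : ModuleCat.{u} R} {n : ℕ}
    (z : (projectiveResolution X).complex.X n ⟶ Y)
    (hz : (projectiveResolution X).complex.d (n + 1) n ≫ z = 0) :
    ∃ c : ExtCyc X Y n, extVal c = z := by
  let k : (extComplex X Y).X n ⟶ op (ModuleCat.of R R) :=
    Quiver.Hom.op (ModuleCat.ofHom (LinearMap.toSpanSingleton R _ z))
  have hk : (extComplex X Y).d (n + 1) n ≫ k = 0 := by
    apply Quiver.Hom.unop_inj
    apply ModuleCat.hom_ext
    apply LinearMap.ext_ring
    change (projectiveResolution X).complex.d (n + 1) n ≫ ((1 : R) • z) = 0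
    rw [one_smul, hz]
  refine ⟨((extComplex X Y).descOpcycles k (n + 1) (by simp) hk).unop.hom (1 : R), ?_⟩
  have := (extComplex X Y).p_descOpcycles k (n + 1) (by simp) hk
  have := congrArg (fun f ↦ f.unop.hom (1 : R)) this
  refine this.trans ?_
  change ((1 : R) • z) = z
  rw [one_smul]

lemma extMk_eq_zero_iff {X Y : ModuleCat.{u} R} {n : ℕ} (z : ExtCyc X Y n) :
    extMk z = 0 ↔ ((extComplex X Y).homologyι n).unop.hom z = 0 := by
  have h : Function.Injective ((projectiveResolution X).isoLeftDerivedObj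
    ((linearYoneda R (ModuleCat.{u} R)).obj Y).rightOp n).hom.unop.hom :=
    (ModuleCat.mono_iff_injective _).1 inferInstance
  exact map_eq_zero_iff _ h

lemma extMk_eq_zero_iff_zero {X Y : ModuleCat.{u} R} (z : ExtCyc X Y 0) :
    extMk z = 0 ↔ z = 0 := by
  have h : Function.Injective ((extComplex X Y).homologyι 0).unop.hom := by
    have : IsIso ((extComplex X Y).homologyι 0) := 
      (extComplex X Y).isIso_homologyι 0 _ rfl (by simp)
    exact (ModuleCat.mono_iff_injective _).1 inferInstance
  rw [extMk_eq_zero_iff, map_eq_zero_iff _ h]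

lemma extMk_eq_zero_iff_succ {X Y : ModuleCat.{u} R} {n : ℕ} (z : ExtCyc X Y (n + 1)) :
    extMk z = 0 ↔ ∃ y, extVal z = (projectiveResolution X).complex.d (n + 1) n ≫ y := by
  have hex : (ShortComplex.mk ((extComplex X Y).homologyι (n + 1))
      ((extComplex X Y).fromOpcycles (n + 1) n) (by simp)).Exact :=
    ShortComplex.exact_of_f_is_kernel _ ((extComplex X Y).homologyIsKernel (n + 1) n (by simp))
  have hex' := (ShortComplex.ShortExact.moduleCat_exact_iff_function_exact _).1 hex.unop
  have hp := (extComplex X Y).p_fromOpcycles (n + 1) n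
  rw [extMk_eq_zero_iff]
  refine (hex' z).trans ⟨?_, ?_⟩
  · rintro ⟨y, rfl⟩
    exact ⟨y, congrArg (fun f ↦ f.unop.hom y) hp⟩
  · rintro ⟨y, hy⟩
    refine ⟨y, extVal_injective ?_⟩
    rw [hy]
    exact congrArg (fun f ↦ f.unop.hom y) hp

lemma map_extMk {X Y Y' : ModuleCat.{u} R} {n : ℕ} (g : Y ⟶ Y') (z : ExtCyc X Y n) :
    ∃ z' : ExtCyc X Y' n, extVal z' = extVal z ≫ g ∧
      extMk z' = (((Ext R (ModuleCat.{u} R) n).obj (op X)).map g).hom (extMk z) := by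
  let P := projectiveResolution X
  let α : ((linearYoneda R (ModuleCat.{u} R)).obj Y').rightOp ⟶
    ((linearYoneda R (ModuleCat.{u} R)).obj Y).rightOp :=
    NatTrans.rightOp ((linearYoneda R (ModuleCat.{u} R)).map g)
  let φ : extComplex X Y' ⟶ extComplex X Y := (NatTrans.mapHomologicalComplex α _).app P.complex
  have h1 := HomologicalComplex.p_opcyclesMap φ n
  have h2 := HomologicalComplex.homologyι_naturality φ n
  have h3 := ProjectiveResolution.leftDerived_app_eq α P n
  rw [← Category.assoc, Iso.eq_comp_inv] at h3
  refine ⟨(HomologicalComplex.opcyclesMap φ n).unop.hom z, ?_, ?_⟩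
  · exact congrArg (fun f ↦ f.unop.hom z) h1
  · have h4 := congrArg (fun f ↦ f.unop.hom z) h2
    have h5 := congrArg (fun f ↦ f.unop.hom (((extComplex X Y).homologyι n).unop.hom z)) h3
    exact (congrArg ((P.isoLeftDerivedObj
      ((linearYoneda R (ModuleCat.{u} R)).obj Y').rightOp n)).hom.unop.hom h4).symm.trans h5.symm

lemma comap_extMk {X X' Y : ModuleCat.{u} R} {n : ℕ} (f : X' ⟶ X) (z : ExtCyc X Y n) :
    ∃ z' : ExtCyc X' Y n, extVal z' = (ProjectiveResolution.lift f _ _).f n ≫ extVal z ∧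
      extMk z' = (((Ext R (ModuleCat.{u} R) n).map f.op).app Y).hom (extMk z) := by
  let F := ((linearYoneda R (ModuleCat.{u} R)).obj Y).rightOp
  let φ : extComplex X' Y ⟶ extComplex X Y := (F.mapHomologicalComplex _).map
    (ProjectiveResolution.lift f (projectiveResolution X') (projectiveResolution X))
  have h1 := HomologicalComplex.p_opcyclesMap φ n
  have h2 := HomologicalComplex.homologyι_naturality φ n
  have h3 := ProjectiveResolution.isoLeftDerivedObj_hom_naturality f (projectiveResolution X')
    (projectiveResolution X) (ProjectiveResolution.lift f _ _)
    (ProjectiveResolution.lift_commutes_zero f _ _) F n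
  refine ⟨(HomologicalComplex.opcyclesMap φ n).unop.hom z, ?_, ?_⟩
  · exact congrArg (fun f ↦ f.unop.hom z) h1
  · have h4 := congrArg (fun f ↦ f.unop.hom z) h2
    have h5 := congrArg (fun f ↦ f.unop.hom (((extComplex X Y).homologyι n).unop.hom z)) h3
    exact (congrArg ((projectiveResolution X').isoLeftDerivedObj F n).hom.unop.hom h4).symm.trans
      h5.symm

end ExtCocycles

section LocalCohomologyClasses

open Limits Opposite

variable {R : Type} [CommRing R]

/-- A projective resolution of `R ⧸ J ^ t`. -/
noncomputable abbrev powRes (J : Ideal R) (t : ℕ) :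
    ProjectiveResolution (ModuleCat.of R (R ⧸ J ^ t)) :=
  projectiveResolution _

/-- The projection `R ⧸ J ^ t' ⟶ R ⧸ J ^ t`. -/
noncomputable abbrev powProj (J : Ideal R) {t t' : ℕ} (h : t ≤ t') :
    ModuleCat.of R (R ⧸ J ^ t') ⟶ ModuleCat.of R (R ⧸ J ^ t) :=
  ModuleCat.ofHom (Submodule.mapQ _ _ LinearMap.id (Ideal.pow_le_pow_right h))

/-- The lift of `powProj` to resolutions. -/
noncomputable abbrev powLift (J : Ideal R) {t t' : ℕ} (h : t ≤ t') :
    (powRes J t').complex ⟶ (powRes J t).complex :=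
  ProjectiveResolution.lift (powProj J h) _ _

/-- The structure map from `Ext (R ⧸ J ^ t) N` to local cohomology. -/
noncomputable def lcι (J : Ideal R) (i t : ℕ) (N : ModuleCat R) :
    (((Ext R (ModuleCat R) i).obj (op (ModuleCat.of R (R ⧸ J ^ t)))).obj N) →ₗ[R]
      ((localCohomology J i).obj N) :=
  ((colimit.ι (localCohomology.diagram (localCohomology.idealPowersDiagram J) i)
    (op (op t))).app N).hom

/-- The cocycle `z : P_i ⟶ N`, for `P` a resolution of `R ⧸ J ^ t`, represents the class `a`
in local cohomology. -/
def IsLCClass (J : Ideal R) (i t : ℕ) {N : ModuleCat R} (z : (powRes J t).complex.X i ⟶ N)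
    (a : (localCohomology J i).obj N) : Prop :=
  ∃ c : ExtCyc (ModuleCat.of R (R ⧸ J ^ t)) N i, extVal c = z ∧
    lcι J i t N (extMk c) = a

namespace IsLCClass

variable {J : Ideal R} {i t t' : ℕ} {N N' : ModuleCat R}
  {z z' : (powRes J t).complex.X i ⟶ N} {a a' : (localCohomology J i).obj N}

lemma d_comp (h : IsLCClass J i t z a) : (powRes J t).complex.d (i + 1) i ≫ z = 0 := by
  obtain ⟨c, rfl, -⟩ := h
  exact d_extVal c

lemma exists_of_d_comp (hz : (powRes J t).complex.d (i + 1) i ≫ z = 0) :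
    ∃ a, IsLCClass J i t z a := by
  obtain ⟨c, hc⟩ := exists_extVal_eq z hz
  exact ⟨_, c, hc, rfl⟩

lemma unique (h : IsLCClass J i t z a) (h' : IsLCClass J i t z a') : a = a' := by
  obtain ⟨c, hc, rfl⟩ := h
  obtain ⟨c', hc', rfl⟩ := h'
  rw [extVal_injective (hc.trans hc'.symm)]

lemma add (h : IsLCClass J i t z a) (h' : IsLCClass J i t z' a') :
    IsLCClass J i t (z + z') (a + a') := by
  obtain ⟨c, rfl, rfl⟩ := h
  obtain ⟨c', rfl, rfl⟩ := h'
  exact ⟨c + c', map_add _ _ _, by rw [map_add, map_add]⟩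

lemma smul (r : R) (h : IsLCClass J i t z a) : IsLCClass J i t (r • z) (r • a) := by
  obtain ⟨c, rfl, rfl⟩ := h
  exact ⟨r • c, map_smul _ _ _, by rw [map_smul, map_smul]⟩

lemma map (g : N ⟶ N') (h : IsLCClass J i t z a) :
    IsLCClass J i t (z ≫ g) (((localCohomology J i).map g).hom a) := by
  obtain ⟨c, rfl, rfl⟩ := h
  obtain ⟨c', h1, h2⟩ := map_extMk g c
  refine ⟨c', h1, ?_⟩
  rw [h2]
  exact congrArg (fun f ↦ f.hom (extMk c)) ((colimit.ι (localCohomology.diagram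
    (localCohomology.idealPowersDiagram J) i) (op (op t))).naturality g)

lemma comap (ht : t ≤ t') (h : IsLCClass J i t z a) :
    IsLCClass J i t' ((powLift J ht).f i ≫ z) a := by
  obtain ⟨c, rfl, rfl⟩ := h
  obtain ⟨c', h1, h2⟩ := comap_extMk (powProj J ht) c
  refine ⟨c', h1, ?_⟩
  rw [h2]
  have := colimit.w (localCohomology.diagram (localCohomology.idealPowersDiagram J) i)
    (homOfLE ht).op.op
  exact congrArg (fun f ↦ (f.app N).hom (extMk c)) this

variable (J i N) in
/-- Evaluation of the colimit defining local cohomology. -/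
noncomputable def isColimitEval : IsColimit (((evaluation _ _).obj N).mapCocone
    (colimit.cocone (localCohomology.diagram (localCohomology.idealPowersDiagram J) i))) :=
  isColimitOfPreserves _ (colimit.isColimit _)

lemma exists_rep (a : (localCohomology J i).obj N) :
    ∃ t, ∃ z : (powRes J t).complex.X i ⟶ N, IsLCClass J i t z a := by
  obtain ⟨t, y, rfl⟩ := Concrete.isColimit_exists_rep _ (isColimitEval J i N) a
  obtain ⟨c, rfl⟩ := extMk_surjective y
  exact ⟨t.unop.unop, _, c, rfl, rfl⟩

lemma exists_extMk_eq_zero (h : IsLCClass J i t z 0) :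
    ∃ (t' : ℕ) (ht : t ≤ t') (c : ExtCyc (ModuleCat.of R (R ⧸ J ^ t')) N i),
      extVal c = (powLift J ht).f i ≫ z ∧ extMk c = 0 := by
  obtain ⟨c, rfl, hc⟩ := h
  obtain ⟨k, f, g, hk⟩ := (Concrete.isColimit_rep_eq_iff_exists (i := op (op t)) (j := op (op t))
    _ (isColimitEval J i N) (extMk c) 0).1 (hc.trans (map_zero _).symm)
  rw [map_zero] at hk
  obtain ⟨c', h1, h2⟩ := comap_extMk (powProj J (leOfHom f.unop.unop)) c
  exact ⟨k.unop.unop, leOfHom f.unop.unop, c', h1, h2.trans hk⟩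

lemma exists_eq_zero {z : (powRes J t).complex.X 0 ⟶ N} (h : IsLCClass J 0 t z 0) :
    ∃ (t' : ℕ) (ht : t ≤ t'), (powLift J ht).f 0 ≫ z = 0 := by
  obtain ⟨t', ht, c, h1, h2⟩ := h.exists_extMk_eq_zero
  refine ⟨t', ht, ?_⟩
  rw [← h1, (extMk_eq_zero_iff_zero c).1 h2, map_zero]

lemma exists_eq_d_comp {z : (powRes J t).complex.X (i + 1) ⟶ N} (h : IsLCClass J (i + 1) t z 0) :
    ∃ (t' : ℕ) (ht : t ≤ t') (y : (powRes J t').complex.X i ⟶ N),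
      (powLift J ht).f (i + 1) ≫ z = (powRes J t').complex.d (i + 1) i ≫ y := by
  obtain ⟨t', ht, c, h1, h2⟩ := h.exists_extMk_eq_zero
  obtain ⟨y, hy⟩ := (extMk_eq_zero_iff_succ c).1 h2
  exact ⟨t', ht, y, h1.symm.trans hy⟩

lemma of_d_comp (y : (powRes J t).complex.X i ⟶ N) :
    IsLCClass J (i + 1) t ((powRes J t).complex.d (i + 1) i ≫ y) 0 := by
  obtain ⟨c, hc⟩ := exists_extVal_eq (n := i + 1) ((powRes J t).complex.d (i + 1) i ≫ y) (by simp)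
  refine ⟨c, hc, ?_⟩
  rw [(extMk_eq_zero_iff_succ c).2 ⟨y, hc⟩, map_zero]

end IsLCClass

end LocalCohomologyClasses

section LocalCohomologySequence

open Limits Opposite

lemma exists_linearMap_of_rel {R A B : Type} [CommRing R] [AddCommGroup A] [AddCommGroup B]
    [Module R A] [Module R B] (r : A → B → Prop) (total : ∀ a, ∃ b, r a b)
    (hadd : ∀ a b a' b', r a b → r a' b' → r (a + a') (b + b'))
    (hsmul : ∀ (c : R) a b, r a b → r (c • a) (c • b)) (hzero : ∀ b, r 0 b → b = 0) :
    ∃ φ : A →ₗ[R] B, ∀ a b, r a b ↔ φ a = b := by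
  choose f hf using total
  have huniq : ∀ a b, r a b → f a = b := fun a b h ↦ by
    have := hadd _ _ _ _ (hf a) (hsmul (-1) _ _ h)
    rw [neg_one_smul, neg_one_smul, add_neg_cancel] at this
    exact sub_eq_zero.1 (by rw [sub_eq_add_neg]; exact hzero _ this)
  exact ⟨{ toFun := f
           map_add' := fun a b ↦ huniq _ _ (hadd _ _ _ _ (hf a) (hf b))
           map_smul' := fun c a ↦ huniq _ _ (hsmul c _ _ (hf a)) },
    fun a b ↦ ⟨huniq a b, fun h ↦ h ▸ hf a⟩⟩

variable {R : Type} [CommRing R] {J : Ideal R} {N N' N'' : Type} [AddCommGroup N]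
  [AddCommGroup N'] [AddCommGroup N''] [Module R N] [Module R N'] [Module R N'']

/-- Local cohomology of an unbundled module. -/
abbrev LCoh (J : Ideal R) (i : ℕ) (N : Type) [AddCommGroup N] [Module R N] : Type :=
  (localCohomology J i).obj (ModuleCat.of R N)

/-- The map induced on local cohomology. -/
noncomputable def lcMap (J : Ideal R) (i : ℕ) (f : N →ₗ[R] N') : LCoh J i N →ₗ[R] LCoh J i N' :=
  ((localCohomology J i).map (ModuleCat.ofHom f)).hom

/-- The cocycle `z : P_i → N` represents the class `a` in local cohomology. -/
def LCRep (J : Ideal R) (i t : ℕ) (z : (powRes J t).complex.X i →ₗ[R] N) (a : LCoh J i N) :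
    Prop :=
  IsLCClass J i t (ModuleCat.ofHom z) a

/-- The differential of the resolution of `R ⧸ J ^ t`. -/
noncomputable abbrev powD (J : Ideal R) (t i j : ℕ) :
    (powRes J t).complex.X i →ₗ[R] (powRes J t).complex.X j :=
  ((powRes J t).complex.d i j).hom

/-- The comparison of resolutions. -/
noncomputable abbrev powL (J : Ideal R) {t t' : ℕ} (ht : t ≤ t') (i : ℕ) :
    (powRes J t').complex.X i →ₗ[R] (powRes J t).complex.X i :=
  ((powLift J ht).f i).hom

lemma powL_comp_powD {t t' : ℕ} (ht : t ≤ t') (i j : ℕ) :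
    powL J ht j ∘ₗ powD J t' i j = powD J t i j ∘ₗ powL J ht i :=
  congrArg ModuleCat.Hom.hom ((powLift J ht).comm i j).symm

lemma exists_lift {t i : ℕ} {g : N →ₗ[R] N''} (hg : Function.Surjective g)
    (z : (powRes J t).complex.X i →ₗ[R] N'') : ∃ y, g ∘ₗ y = z := by
  have := (ModuleCat.epi_iff_surjective (ModuleCat.ofHom g)).2 hg
  have := (powRes J t).projective i
  let z' : (powRes J t).complex.X i ⟶ ModuleCat.of R N'' := ModuleCat.ofHom z
  exact ⟨(Projective.factorThru z' (ModuleCat.ofHom g)).hom,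
    congrArg ModuleCat.Hom.hom (Projective.factorThru_comp z' _)⟩

lemma exists_comp_eq_of_exact {A : Type} [AddCommGroup A] [Module R A] {f : N' →ₗ[R] N}
    {g : N →ₗ[R] N''} (hf : Function.Injective f) (hfg : Function.Exact f g) (z : A →ₗ[R] N)
    (hz : g ∘ₗ z = 0) : ∃ y, f ∘ₗ y = z := by
  refine ⟨(LinearEquiv.ofInjective f hf).symm.toLinearMap ∘ₗ z.codRestrict _ fun a ↦
    (hfg _).1 (LinearMap.congr_fun hz a), LinearMap.ext fun a ↦ ?_⟩
  exact congrArg Subtype.val ((LinearEquiv.ofInjective f hf).apply_symm_apply _)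

namespace LCRep

variable {i t t' : ℕ} {z z' : (powRes J t).complex.X i →ₗ[R] N} {a a' : LCoh J i N}

lemma comp_d (h : LCRep J i t z a) : z ∘ₗ powD J t (i + 1) i = 0 :=
  congrArg ModuleCat.Hom.hom (IsLCClass.d_comp h)

lemma exists_of_comp_d (hz : z ∘ₗ powD J t (i + 1) i = 0) : ∃ a, LCRep J i t z a :=
  IsLCClass.exists_of_d_comp (ModuleCat.hom_ext hz)

lemma unique (h : LCRep J i t z a) (h' : LCRep J i t z a') : a = a' :=
  IsLCClass.unique h h'

lemma add (h : LCRep J i t z a) (h' : LCRep J i t z' a') : LCRep J i t (z + z') (a + a') :=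
  IsLCClass.add h h'

lemma smul (r : R) (h : LCRep J i t z a) : LCRep J i t (r • z) (r • a) :=
  IsLCClass.smul r h

lemma sub (h : LCRep J i t z a) (h' : LCRep J i t z' a') : LCRep J i t (z - z') (a - a') := by
  have := h.add (h'.smul (-1))
  rwa [neg_one_smul, neg_one_smul, ← sub_eq_add_neg, ← sub_eq_add_neg] at this

lemma map (g : N →ₗ[R] N') (h : LCRep J i t z a) : LCRep J i t (g ∘ₗ z) (lcMap J i g a) :=
  IsLCClass.map (ModuleCat.ofHom g) h

lemma comap (ht : t ≤ t') (h : LCRep J i t z a) : LCRep J i t' (z ∘ₗ powL J ht i) a :=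
  IsLCClass.comap ht h

lemma exists_rep (a : LCoh J i N) : ∃ t, ∃ z, LCRep J i t z a := by
  obtain ⟨t, z, h⟩ := IsLCClass.exists_rep a
  exact ⟨t, z.hom, h⟩

lemma exists_eq_zero {z : (powRes J t).complex.X 0 →ₗ[R] N} (h : LCRep J 0 t z 0) :
    ∃ (t' : ℕ) (ht : t ≤ t'), z ∘ₗ powL J ht 0 = 0 := by
  obtain ⟨t', ht, h⟩ := IsLCClass.exists_eq_zero h
  exact ⟨t', ht, congrArg ModuleCat.Hom.hom h⟩

lemma exists_eq_comp_d {z : (powRes J t).complex.X (i + 1) →ₗ[R] N} (h : LCRep J (i + 1) t z 0) :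
    ∃ (t' : ℕ) (ht : t ≤ t') (y : (powRes J t').complex.X i →ₗ[R] N),
      z ∘ₗ powL J ht (i + 1) = y ∘ₗ powD J t' (i + 1) i := by
  obtain ⟨t', ht, y, h⟩ := IsLCClass.exists_eq_d_comp h
  exact ⟨t', ht, y.hom, congrArg ModuleCat.Hom.hom h⟩

lemma of_comp_d (y : (powRes J t).complex.X i →ₗ[R] N) :
    LCRep J (i + 1) t (y ∘ₗ powD J t (i + 1) i) 0 :=
  IsLCClass.of_d_comp (ModuleCat.ofHom y)

lemma zero : LCRep J i t (0 : _ →ₗ[R] N) 0 := by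
  obtain ⟨a, ha⟩ := exists_of_comp_d (J := J) (i := i) (t := t)
    (z := (0 : _ →ₗ[R] N)) (by simp)
  simpa using ha.smul 0

lemma exists_lift_zero {g : N →ₗ[R] N''} (hg : Function.Surjective g)
    {z : (powRes J t).complex.X i →ₗ[R] N''} (h : LCRep J i t z 0) :
    ∃ (t' : ℕ) (ht : t ≤ t') (c : (powRes J t').complex.X i →ₗ[R] N),
      LCRep J i t' c 0 ∧ g ∘ₗ c = z ∘ₗ powL J ht i := by
  cases i with
  | zero =>
    obtain ⟨t', ht, h⟩ := h.exists_eq_zero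
    exact ⟨t', ht, 0, zero, by simp [h]⟩
  | succ i =>
    obtain ⟨t', ht, u, h⟩ := h.exists_eq_comp_d
    obtain ⟨v, rfl⟩ := exists_lift hg u
    exact ⟨t', ht, _, of_comp_d v, h.symm⟩

end LCRep

variable {f : N' →ₗ[R] N} {g : N →ₗ[R] N''} {i : ℕ}

@[simp] lemma lcMap_id : lcMap J i (LinearMap.id : N →ₗ[R] N) = LinearMap.id :=
  congrArg ModuleCat.Hom.hom ((localCohomology J i).map_id (ModuleCat.of R N))

lemma lcMap_comp (f : N' →ₗ[R] N) (g : N →ₗ[R] N'') :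
    lcMap J i (g ∘ₗ f) = lcMap J i g ∘ₗ lcMap J i f :=
  congrArg ModuleCat.Hom.hom ((localCohomology J i).map_comp (ModuleCat.ofHom f)
    (ModuleCat.ofHom g))

lemma lcMap_add (f f' : N' →ₗ[R] N) : lcMap J i (f + f') = lcMap J i f + lcMap J i f' := by
  ext a
  obtain ⟨t, z, h⟩ := LCRep.exists_rep a
  exact (h.map (f + f')).unique ((h.map f).add (h.map f'))

lemma lcMap_smul (r : R) (f : N' →ₗ[R] N) : lcMap J i (r • f) = r • lcMap J i f := by
  ext a
  obtain ⟨t, z, h⟩ := LCRep.exists_rep a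
  exact (h.map (r • f)).unique ((h.map f).smul r)

lemma lcMap_exact (hf : Function.Injective f) (hg : Function.Surjective g)
    (hfg : Function.Exact f g) : Function.Exact (lcMap J i f) (lcMap J i g) := by
  refine fun a ↦ ⟨fun h ↦ ?_, ?_⟩
  · obtain ⟨t, z, hz⟩ := LCRep.exists_rep a
    have h' := hz.map g
    rw [h] at h'
    obtain ⟨t', ht, c, hc, hgc⟩ := h'.exists_lift_zero hg
    have hs := (hz.comap ht).sub hc
    obtain ⟨y, hy⟩ := exists_comp_eq_of_exact hf hfg (z ∘ₗ powL J ht i - c)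
      (by rw [LinearMap.comp_sub, hgc, LinearMap.comp_assoc, sub_self])
    rw [← hy, sub_zero] at hs
    obtain ⟨b, hb⟩ := LCRep.exists_of_comp_d (z := y) (J := J) (i := i) (t := t') <| by
      refine LinearMap.ext fun p ↦ hf ?_
      simpa using LinearMap.congr_fun hs.comp_d p
    exact ⟨b, (hb.map f).unique hs⟩
  · rintro ⟨b, rfl⟩
    obtain ⟨t, z, hz⟩ := LCRep.exists_rep b
    refine ((hz.map f).map g).unique ?_
    rw [← LinearMap.comp_assoc, hfg.linearMap_comp_eq_zero, LinearMap.zero_comp]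
    exact LCRep.zero

lemma lcMap_zero_injective (hf : Function.Injective f) : Function.Injective (lcMap J 0 f) := by
  rw [injective_iff_map_eq_zero]
  intro a ha
  obtain ⟨t, z, hz⟩ := LCRep.exists_rep a
  have h := hz.map f
  rw [ha] at h
  obtain ⟨t', ht, h⟩ := h.exists_eq_zero
  refine (hz.comap ht).unique ?_
  rw [show z ∘ₗ powL J ht 0 = 0 from LinearMap.ext fun p ↦ hf ?_]
  · exact LCRep.zero
  · simpa using LinearMap.congr_fun h p

/-- The connecting homomorphism, as a relation. -/
private def ConnRel (J : Ideal R) (i : ℕ) (f : N' →ₗ[R] N) (g : N →ₗ[R] N'')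
    (a : LCoh J i N'') (b : LCoh J (i + 1) N') : Prop :=
  ∃ (t : ℕ) (y : (powRes J t).complex.X i →ₗ[R] N) (w : (powRes J t).complex.X (i + 1) →ₗ[R] N'),
    f ∘ₗ w = y ∘ₗ powD J t (i + 1) i ∧ LCRep J i t (g ∘ₗ y) a ∧ LCRep J (i + 1) t w b

lemma powD_comp (t i : ℕ) : powD J t (i + 1) i ∘ₗ powD J t (i + 2) (i + 1) = 0 :=
  congrArg ModuleCat.Hom.hom ((powRes J t).complex.d_comp_d (i + 2) (i + 1) i)

lemma exists_connecting (i : ℕ) (hf : Function.Injective f) (hg : Function.Surjective g)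
    (hfg : Function.Exact f g) : ∃ δ : LCoh J i N'' →ₗ[R] LCoh J (i + 1) N',
      Function.Exact (lcMap J i g) δ ∧ Function.Exact δ (lcMap J (i + 1) f) := by
  have hgf := hfg.linearMap_comp_eq_zero
  have comap : ∀ {t t' : ℕ} (ht : t ≤ t') {y : (powRes J t).complex.X i →ₗ[R] N}
      {w : (powRes J t).complex.X (i + 1) →ₗ[R] N'}, f ∘ₗ w = y ∘ₗ powD J t (i + 1) i →
      f ∘ₗ (w ∘ₗ powL J ht _) = (y ∘ₗ powL J ht _) ∘ₗ powD J t' (i + 1) i := by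
    intro t t' ht y w h
    rw [← LinearMap.comp_assoc, h, LinearMap.comp_assoc, LinearMap.comp_assoc, powL_comp_powD]
  have key : ∀ {t : ℕ} {y : (powRes J t).complex.X i →ₗ[R] N}
      {w : (powRes J t).complex.X (i + 1) →ₗ[R] N'} {y' : (powRes J t).complex.X i →ₗ[R] N'},
      f ∘ₗ w = y ∘ₗ powD J t (i + 1) i → y ∘ₗ powD J t (i + 1) i =
      (f ∘ₗ y') ∘ₗ powD J t (i + 1) i → w = y' ∘ₗ powD J t (i + 1) i := by
    intro t y w y' h h'
    refine LinearMap.ext fun p ↦ hf ?_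
    exact LinearMap.congr_fun (h.trans h') p
  have hrel : ∃ δ : LCoh J i N'' →ₗ[R] LCoh J (i + 1) N',
      ∀ a b, ConnRel J i f g a b ↔ δ a = b := by
    refine exists_linearMap_of_rel _ ?_ ?_ ?_ ?_
    · intro a
      obtain ⟨t, z, hz⟩ := LCRep.exists_rep a
      obtain ⟨y, rfl⟩ := exists_lift hg z
      obtain ⟨w, hw⟩ := exists_comp_eq_of_exact hf hfg (y ∘ₗ powD J t (i + 1) i) hz.comp_d
      obtain ⟨b, hb⟩ := LCRep.exists_of_comp_d (J := J) (i := i + 1) (t := t) (z := w) <| by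
        refine LinearMap.ext fun p ↦ hf ?_
        have := LinearMap.congr_fun hw (powD J t (i + 2) (i + 1) p)
        refine this.trans ?_
        simpa using congrArg y (LinearMap.congr_fun (powD_comp (J := J) t i) p)
      exact ⟨b, t, y, w, hw, hz, hb⟩
    · rintro a b a' b' ⟨t, y, w, h, ha, hb⟩ ⟨t', y', w', h', ha', hb'⟩
      have e := comap (le_max_left t t') h
      have e' := comap (le_max_right t t') h'
      refine ⟨max t t', y ∘ₗ powL J (le_max_left t t') i + y' ∘ₗ powL J (le_max_right t t') i, _,
        ?_, ?_, (hb.comap (le_max_left t t')).add (hb'.comap (le_max_right t t'))⟩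
      · rw [LinearMap.comp_add, e, e', LinearMap.add_comp]
      · rw [LinearMap.comp_add]
        exact (ha.comap (le_max_left t t')).add (ha'.comap (le_max_right t t'))
    · rintro c a b ⟨t, y, w, h, ha, hb⟩
      refine ⟨t, c • y, c • w, ?_, ?_, hb.smul c⟩
      · rw [LinearMap.comp_smul, h, LinearMap.smul_comp]
      · rw [LinearMap.comp_smul]
        exact ha.smul c
    · rintro b ⟨t, y, w, h, ha, hb⟩
      obtain ⟨t', ht, c, hc, hgc⟩ := ha.exists_lift_zero hg
      obtain ⟨y', hy'⟩ := exists_comp_eq_of_exact hf hfg (y ∘ₗ powL J ht i - c)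
        (by rw [LinearMap.comp_sub, hgc, LinearMap.comp_assoc, sub_self])
      refine (hb.comap ht).unique ?_
      rw [key (comap ht h) (y' := y') (by rw [hy', LinearMap.sub_comp, hc.comp_d, sub_zero])]
      exact LCRep.of_comp_d y'
  obtain ⟨δ, hδ⟩ := hrel
  refine ⟨δ, fun a ↦ ⟨fun h ↦ ?_, ?_⟩, fun b ↦ ⟨fun h ↦ ?_, ?_⟩⟩
  · obtain ⟨t, y, w, hyw, ha, hb⟩ := (hδ _ _).2 h
    obtain ⟨t', ht, y', h⟩ := hb.exists_eq_comp_d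
    have hyw' := comap ht hyw
    rw [h] at hyw'
    obtain ⟨b, hb⟩ := LCRep.exists_of_comp_d (J := J) (i := i) (t := t')
      (z := y ∘ₗ powL J ht i - f ∘ₗ y') <| by
        rw [LinearMap.sub_comp, ← hyw', LinearMap.comp_assoc, sub_self]
    refine ⟨b, (hb.map g).unique ?_⟩
    rw [LinearMap.comp_sub, ← LinearMap.comp_assoc _ f g, hgf, LinearMap.zero_comp, sub_zero]
    exact ha.comap ht
  · rintro ⟨b, rfl⟩
    obtain ⟨t, z, hz⟩ := LCRep.exists_rep b
    exact (hδ _ _).1 ⟨t, z, 0, by rw [hz.comp_d, LinearMap.comp_zero], hz.map g, LCRep.zero⟩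
  · obtain ⟨t, w, hw⟩ := LCRep.exists_rep b
    have h' := hw.map f
    rw [h] at h'
    obtain ⟨t', ht, y, hy⟩ := h'.exists_eq_comp_d
    obtain ⟨a, ha⟩ := LCRep.exists_of_comp_d (J := J) (i := i) (t := t') (z := g ∘ₗ y) <| by
      rw [LinearMap.comp_assoc, ← hy, LinearMap.comp_assoc, ← LinearMap.comp_assoc _ f g, hgf,
        LinearMap.zero_comp]
    exact ⟨a, (hδ _ _).1 ⟨t', y, _, hy, ha, hw.comap ht⟩⟩
  · rintro ⟨a, rfl⟩
    obtain ⟨t, y, w, hyw, ha, hb⟩ := (hδ a _).2 rfl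
    refine (hb.map f).unique ?_
    rw [hyw]
    exact LCRep.of_comp_d y

end LocalCohomologySequence

section LocalCohomologyTorsion

open Limits

variable {R : Type} [CommRing R] {J : Ideal R} {N N' : Type} [AddCommGroup N]
  [AddCommGroup N'] [Module R N] [Module R N']

lemma lc_subsingleton_of_injective (i : ℕ) [Module.Injective R N] :
    Subsingleton (LCoh J (i + 1) N) := by
  refine subsingleton_of_forall_eq 0 fun a ↦ ?_
  obtain ⟨t, z, hz⟩ := LCRep.exists_rep a
  have : Injective (ModuleCat.of R N) := Module.injective_object_of_injective_module R N
  let z' : (powRes J t).complex.X (i + 1) ⟶ ModuleCat.of R N := ModuleCat.ofHom z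
  have hz' : (powRes J t).complex.d (i + 2) (i + 1) ≫ z' = 0 := IsLCClass.d_comp hz
  have h := ((powRes J t).exact_succ i).comp_descToInjective z' hz'
  have h' := LCRep.of_comp_d (J := J) (t := t) (i := i) (N := N)
    (((powRes J t).exact_succ i).descToInjective z' hz').hom
  rw [show z = _ from (congrArg ModuleCat.Hom.hom h).symm] at hz
  exact hz.unique h'

/-- The augmentation of the resolution of `R ⧸ J ^ t`. -/
noncomputable def powAug (J : Ideal R) (t : ℕ) : (powRes J t).complex.X 0 →ₗ[R] R ⧸ J ^ t :=
  let π₀ : (powRes J t).complex.X 0 ⟶ ModuleCat.of R (R ⧸ J ^ t) := (powRes J t).π.f 0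
  π₀.hom

lemma powAug_surjective (t : ℕ) : Function.Surjective (powAug J t) :=
  (ModuleCat.epi_iff_surjective ((powRes J t).π.f 0)).1 inferInstance

lemma powAug_exact (t : ℕ) : Function.Exact (powD J t 1 0) (powAug J t) :=
  (ShortComplex.ShortExact.moduleCat_exact_iff_function_exact _).1 (powRes J t).exact₀

lemma powAug_comp_powL {t t' : ℕ} (ht : t ≤ t') :
    powAug J t ∘ₗ powL J ht 0 = (powProj J ht).hom ∘ₗ powAug J t' :=
  congrArg ModuleCat.Hom.hom
    (ProjectiveResolution.lift_commutes_zero (powProj J ht) (powRes J t') (powRes J t))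

lemma LCRep.smul_eq_zero {t i : ℕ} {z : (powRes J t).complex.X i →ₗ[R] N} {a : LCoh J i N}
    (h : LCRep J i t z a) {r : R} (hr : r ∈ J ^ t) : r • a = 0 := by
  let f : (powRes J t).complex ⟶ (powRes J t).complex := r • 𝟙 _
  have h0 : f ≫ (powRes J t).π = 0 := by
    refine HomologicalComplex.to_single_hom_ext ?_
    refine ModuleCat.hom_ext (LinearMap.ext fun p ↦ ?_)
    change powAug J t (r • p) = 0
    rw [map_smul]
    obtain ⟨q, hq⟩ := Ideal.Quotient.mk_surjective (powAug J t p)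
    rw [← hq]
    exact Ideal.Quotient.eq_zero_iff_mem.2 (Ideal.mul_mem_right q _ hr)
  have hom := ProjectiveResolution.liftHomotopyZero f h0
  have hc := hom.comm i
  have hz : (powRes J t).complex.d (i + 1) i ≫ ModuleCat.ofHom z = 0 := IsLCClass.d_comp h
  have hr' : f.f i = r • 𝟙 _ := rfl
  have hs : LCRep J i t (r • z) (r • a) := h.smul r
  refine hs.unique ?_
  have e : r • z = (f.f i ≫ ModuleCat.ofHom z).hom := by
    rw [hr', Linear.smul_comp, Category.id_comp]
    rfl
  rw [e, hc, prevD_eq hom.hom (j := i) (j' := i + 1) rfl]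
  cases i with
  | zero =>
    rw [Homotopy.dNext_zero_chainComplex]
    simp only [HomologicalComplex.zero_f, zero_add, add_zero, Category.assoc]
    erw [hz]
    rw [comp_zero]
    exact LCRep.zero
  | succ i =>
    rw [Homotopy.dNext_succ_chainComplex]
    simp only [HomologicalComplex.zero_f, Preadditive.add_comp, add_zero, Category.assoc]
    erw [hz]
    rw [comp_zero, add_zero]
    exact LCRep.of_comp_d _

lemma lc_torsion {i : ℕ} (a : LCoh J i N) : ∃ t, ∀ r ∈ J ^ t, r • a = 0 := by
  obtain ⟨t, z, hz⟩ := LCRep.exists_rep a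
  exact ⟨t, fun r hr ↦ hz.smul_eq_zero hr⟩

lemma LCRep.exists_of_quotient {t : ℕ} (φ : R ⧸ J ^ t →ₗ[R] N) :
    ∃ a, LCRep J 0 t (φ ∘ₗ powAug J t) a :=
  LCRep.exists_of_comp_d <| by
    rw [LinearMap.comp_assoc, (powAug_exact t).linearMap_comp_eq_zero, LinearMap.comp_zero]

lemma LCRep.exists_quotient_rep (a : LCoh J 0 N) :
    ∃ t, ∃ φ : R ⧸ J ^ t →ₗ[R] N, LCRep J 0 t (φ ∘ₗ powAug J t) a := by
  obtain ⟨t, z, hz⟩ := LCRep.exists_rep a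
  have hle : LinearMap.ker (powAug J t) ≤ LinearMap.ker z := by
    intro p hp
    obtain ⟨q, rfl⟩ := (powAug_exact t p).1 hp
    exact LinearMap.congr_fun hz.comp_d q
  obtain ⟨φ, hφ⟩ : ∃ φ : R ⧸ J ^ t →ₗ[R] N, φ ∘ₗ powAug J t = z :=
    ⟨(LinearMap.ker (powAug J t)).liftQ z hle ∘ₗ
      ((powAug J t).quotKerEquivOfSurjective (powAug_surjective t)).symm.toLinearMap,
      LinearMap.ext fun p ↦ by
        have : ((powAug J t).quotKerEquivOfSurjective (powAug_surjective t)).symm (powAug J t p) =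
          Submodule.Quotient.mk p := by
          rw [LinearEquiv.symm_apply_eq]; rfl
        simp [this]⟩
  exact ⟨t, φ, hφ ▸ hz⟩

lemma exists_quotient_map {t : ℕ} {n : N} (h : ∀ r ∈ J ^ t, r • n = 0) :
    ∃ φ : R ⧸ J ^ t →ₗ[R] N, φ (Ideal.Quotient.mk _ 1) = n :=
  ⟨(J ^ t).liftQ (LinearMap.toSpanSingleton R N n) fun r hr ↦ h r hr, by
    change (1 : R) • n = n
    rw [one_smul]⟩

lemma quotient_map_ext {I : Ideal R} {φ ψ : R ⧸ I →ₗ[R] N}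
    (h : φ (Ideal.Quotient.mk _ 1) = ψ (Ideal.Quotient.mk _ 1)) : φ = ψ := by
  refine LinearMap.ext fun x ↦ ?_
  obtain ⟨r, rfl⟩ := Ideal.Quotient.mk_surjective x
  have : Ideal.Quotient.mk I r = r • Ideal.Quotient.mk I 1 := by
    rw [← Ideal.Quotient.mk_eq_mk, ← Ideal.Quotient.mk_eq_mk, ← Submodule.Quotient.mk_smul,
      smul_eq_mul, mul_one]
  rw [this, map_smul, map_smul, h]

lemma lc_zero_surjective {g : N →ₗ[R] N'} (hg : Function.Surjective g)
    (hN : ∀ n : N, ∃ t, ∀ r ∈ J ^ t, r • n = 0) : Function.Surjective (lcMap J 0 g) := by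
  intro a
  obtain ⟨t, φ, h⟩ := LCRep.exists_quotient_rep a
  obtain ⟨n, hn⟩ := hg (φ (Ideal.Quotient.mk _ 1))
  obtain ⟨t', ht'⟩ := hN n
  have ht : t ≤ max t t' := le_max_left _ _
  obtain ⟨ψ, hψ⟩ := exists_quotient_map (J := J) (t := max t t') (n := n)
    fun r hr ↦ ht' r (Ideal.pow_le_pow_right (le_max_right _ _) hr)
  obtain ⟨b, hb⟩ := LCRep.exists_of_quotient ψ
  refine ⟨b, (hb.map g).unique ?_⟩
  have hc := h.comap ht
  rw [LinearMap.comp_assoc, powAug_comp_powL, ← LinearMap.comp_assoc] at hc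
  rw [← LinearMap.comp_assoc, show g ∘ₗ ψ = φ ∘ₗ (powProj J ht).hom from quotient_map_ext ?_]
  · exact hc
  · exact (congrArg g hψ).trans hn

lemma exists_lc_zero_embedding (J : Ideal R) (N : Type) [AddCommGroup N] [Module R N] :
    ∃ φ : LCoh J 0 N →ₗ[R] N, Function.Injective φ := by
  have comap : ∀ {t t' : ℕ} (ht : t ≤ t') {φ : R ⧸ J ^ t →ₗ[R] N} {a : LCoh J 0 N},
      LCRep J 0 t (φ ∘ₗ powAug J t) a →
      LCRep J 0 t' ((φ ∘ₗ (powProj J ht).hom) ∘ₗ powAug J t') a := by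
    intro t t' ht φ a h
    have hc := h.comap ht
    rwa [LinearMap.comp_assoc, powAug_comp_powL, ← LinearMap.comp_assoc] at hc
  obtain ⟨φ, hφ⟩ : ∃ φ : LCoh J 0 N →ₗ[R] N, ∀ a n, (∃ t, ∃ φ : R ⧸ J ^ t →ₗ[R] N,
      LCRep J 0 t (φ ∘ₗ powAug J t) a ∧ φ (Ideal.Quotient.mk _ 1) = n) ↔ φ a = n := by
    refine exists_linearMap_of_rel _ ?_ ?_ ?_ ?_
    · intro a
      obtain ⟨t, φ, h⟩ := LCRep.exists_quotient_rep a
      exact ⟨_, t, φ, h, rfl⟩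
    · rintro a _ a' _ ⟨t, φ, h, rfl⟩ ⟨t', φ', h', rfl⟩
      refine ⟨max t t', φ ∘ₗ (powProj J (le_max_left t t')).hom +
        φ' ∘ₗ (powProj J (le_max_right t t')).hom, ?_, rfl⟩
      rw [LinearMap.add_comp]
      exact (comap _ h).add (comap _ h')
    · rintro c a _ ⟨t, φ, h, rfl⟩
      refine ⟨t, c • φ, ?_, rfl⟩
      rw [LinearMap.smul_comp]
      exact h.smul c
    · rintro _ ⟨t, φ, h, rfl⟩
      obtain ⟨t', ht, h⟩ := h.exists_eq_zero
      rw [LinearMap.comp_assoc, powAug_comp_powL] at h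
      obtain ⟨p, hp⟩ := powAug_surjective (J := J) t' (Ideal.Quotient.mk _ 1)
      have := LinearMap.congr_fun h p
      simp only [LinearMap.comp_apply, hp] at this
      exact this
  refine ⟨φ, (injective_iff_map_eq_zero φ).2 fun a ha ↦ ?_⟩
  obtain ⟨t, ψ, h, hψ⟩ := (hφ a 0).2 ha
  rw [quotient_map_ext (φ := ψ) (ψ := 0) hψ, LinearMap.zero_comp] at h
  exact h.unique LCRep.zero

end LocalCohomologyTorsion

section ArtinianTorsion

/-- Every element is annihilated by a power of `J`. -/
def IsPowTorsion {R : Type} [CommRing R] (J : Ideal R) (A : Type) [AddCommGroup A] [Module R A] :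
    Prop :=
  ∀ a : A, ∃ t, ∀ r ∈ J ^ t, r • a = 0

variable {R : Type} [CommRing R] {A B : Type} [AddCommGroup A] [Module R A] [AddCommGroup B]
  [Module R B] {J : Ideal R}

lemma IsPowTorsion.of_injective (hA : IsPowTorsion J A) {f : B →ₗ[R] A}
    (hf : Function.Injective f) : IsPowTorsion J B := fun b ↦ by
  obtain ⟨t, ht⟩ := hA (f b)
  exact ⟨t, fun r hr ↦ hf (by rw [map_smul, ht r hr, map_zero])⟩

lemma IsPowTorsion.of_surjective (hA : IsPowTorsion J A) {f : A →ₗ[R] B}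
    (hf : Function.Surjective f) : IsPowTorsion J B := fun b ↦ by
  obtain ⟨a, rfl⟩ := hf b
  obtain ⟨t, ht⟩ := hA a
  exact ⟨t, fun r hr ↦ by rw [← map_smul, ht r hr, map_zero]⟩

lemma IsPowTorsion.pi {n : ℕ} (hA : IsPowTorsion J A) : IsPowTorsion J (Fin n → A) := fun a ↦ by
  choose t ht using fun i ↦ hA (a i)
  exact ⟨Finset.univ.sup t, fun r hr ↦ funext fun i ↦
    ht i r (Ideal.pow_le_pow_right (Finset.le_sup (Finset.mem_univ i)) hr)⟩

/-- Melkersson's criterion. -/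
lemma isArtinian_of_ker_smul (x : R) (htors : ∀ a : A, ∃ n : ℕ, x ^ n • a = 0)
    (h : IsArtinian R (LinearMap.ker (LinearMap.lsmul R A x))) : IsArtinian R A := by
  rw [← monotone_stabilizes_iff_artinian]
  intro F
  let B : ℕ → Submodule R A := fun n ↦ F n
  have hB : ∀ {n n'}, n ≤ n' → B n' ≤ B n := fun hn ↦ F.monotone hn
  let D : ℕ → ℕ → Submodule R (LinearMap.ker (LinearMap.lsmul R A x)) := fun n k ↦
    ((B n).map (LinearMap.lsmul R A (x ^ k))).comap (Submodule.subtype _)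
  have hD : ∀ {n n' k k'}, n ≤ n' → k ≤ k' → D n' k' ≤ D n k := by
    rintro n n' k k' hn hk y ⟨b, hb, hy⟩
    refine ⟨x ^ (k' - k) • b, Submodule.smul_mem _ _ (hB hn hb), ?_⟩
    rw [← hy]
    simp only [LinearMap.lsmul_apply, smul_smul, ← pow_add]
    congr 2
    omega
  obtain ⟨n₀, hn₀⟩ := IsArtinian.monotone_stabilizes (R := R)
    (M := LinearMap.ker (LinearMap.lsmul R A x))
    ⟨fun n ↦ OrderDual.toDual (D n n), fun _ _ h ↦ hD h h⟩
  choose N hN using fun k ↦ IsArtinian.monotone_stabilizes (R := R)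
    (M := LinearMap.ker (LinearMap.lsmul R A x))
    ⟨fun n ↦ OrderDual.toDual (D n k), fun _ _ h ↦ hD h le_rfl⟩
  replace hn₀ : ∀ m, n₀ ≤ m → D n₀ n₀ = D m m := hn₀
  replace hN : ∀ k m, N k ≤ m → D (N k) k = D m k := hN
  let n₁ := max n₀ ((Finset.range n₀).sup N)
  have hst : ∀ n, n₁ ≤ n → ∀ k, D n₁ k ≤ D n k := by
    intro n hn k
    rcases lt_or_ge k n₀ with hk | hk
    · have hk' : N k ≤ n₁ := (Finset.le_sup (Finset.mem_range.2 hk)).trans (le_max_right _ _)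
      rw [← hN k n₁ hk', ← hN k n (hk'.trans hn)]
    · calc D n₁ k ≤ D n₀ n₀ := hD (le_max_left _ _) hk
        _ = D (max n k) (max n k) := hn₀ _ (hk.trans (le_max_right _ _))
        _ ≤ D n k := hD (le_max_left _ _) (le_max_right _ _)
  refine ⟨n₁, fun n hn ↦ ?_⟩
  have key : ∀ j : ℕ, ∀ b ∈ B n₁, x ^ j • b = 0 → b ∈ B n := by
    intro j
    induction j with
    | zero =>
      intro b _ h0
      rw [pow_zero, one_smul] at h0
      rw [h0]
      exact Submodule.zero_mem _
    | succ j ih =>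
      intro b hb h0
      obtain ⟨b', hb', hy⟩ := hst n hn j (x := ⟨x ^ j • b, by
        rw [LinearMap.mem_ker, LinearMap.lsmul_apply, smul_smul, ← pow_succ', h0]⟩) ⟨b, hb, rfl⟩
      replace hy : x ^ j • b' = x ^ j • b := hy
      have := ih (b - b') (Submodule.sub_mem _ hb (hB hn hb')) (by rw [smul_sub, hy, sub_self])
      simpa using Submodule.add_mem _ this hb'
  refine le_antisymm (F.monotone hn) ?_
  intro b hb
  obtain ⟨j, hj⟩ := htors b
  exact key j b hb hj

lemma isArtinian_of_torsionBySet (s : Finset R) (htors : ∀ x ∈ s, ∀ a : A, ∃ n : ℕ, x ^ n • a = 0)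
    (h : IsArtinian R (Submodule.torsionBySet R A (s : Set R))) : IsArtinian R A := by
  classical
  induction s using Finset.induction_on with
  | empty =>
    refine isArtinian_of_injective (LinearMap.id.codRestrict (Submodule.torsionBySet R A
      ((∅ : Finset R) : Set R)) fun a ↦ (Submodule.mem_torsionBySet_iff _ _).2 ?_) ?_
    · rintro ⟨x, hx⟩
      simp at hx
    · exact fun a b h ↦ congrArg Subtype.val h
  | insert x s _ ih =>
    refine ih (fun y hy ↦ htors y (Finset.mem_insert_of_mem hy)) ?_
    refine isArtinian_of_ker_smul x (fun a ↦ ?_) ?_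
    · obtain ⟨n, hn⟩ := htors x (Finset.mem_insert_self _ _) a
      exact ⟨n, Subtype.ext hn⟩
    · refine isArtinian_of_injective (((Submodule.subtype _).comp (Submodule.subtype _)).codRestrict
        (Submodule.torsionBySet R A ((insert x s : Finset R) : Set R)) fun a ↦
          (Submodule.mem_torsionBySet_iff _ _).2 ?_) ?_
      · rintro ⟨y, hy⟩
        rcases Finset.mem_insert.1 hy with rfl | hy
        · exact congrArg Subtype.val a.2
        · exact (Submodule.mem_torsionBySet_iff _ _).1 a.1.2 ⟨y, hy⟩
      · exact fun a b h ↦ Subtype.ext (Subtype.ext (by simpa using congrArg Subtype.val h))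

lemma isArtinian_of_socle [IsNoetherianRing R] (hA : IsPowTorsion J A)
    (h : IsArtinian R (Submodule.torsionBySet R A (J : Set R))) : IsArtinian R A := by
  obtain ⟨s, hs⟩ := (isNoetherianRing_iff_ideal_fg R).1 ‹_› J
  refine isArtinian_of_torsionBySet s (fun x hx a ↦ ?_) ?_
  · obtain ⟨t, ht⟩ := hA a
    exact ⟨t, ht _ (Ideal.pow_mem_pow (hs ▸ Submodule.subset_span hx) t)⟩
  · have : Submodule.torsionBySet R A (s : Set R) = Submodule.torsionBySet R A (J : Set R) := by
      rw [← hs]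
      exact Submodule.torsionBySet_eq_torsionBySet_span _
    rwa [this]

end ArtinianTorsion

section Matlis

variable {R : Type} [CommRing R] {E : Type} [AddCommGroup E] [Module R E]
  {A B : Type} [AddCommGroup A] [Module R A] [AddCommGroup B] [Module R B]

lemma exists_comp_eq_of_ker_le [Module.Injective R E] (φ : A →ₗ[R] B) (f : A →ₗ[R] E)
    (h : LinearMap.ker φ ≤ LinearMap.ker f) : ∃ g : B →ₗ[R] E, g ∘ₗ φ = f := by
  let φ' := (LinearMap.ker φ).liftQ φ le_rfl
  have hφ' : Function.Injective φ' :=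
    LinearMap.ker_eq_bot.1 (Submodule.ker_liftQ_eq_bot _ _ _ le_rfl)
  obtain ⟨g, hg⟩ := Module.Injective.out φ' hφ' ((LinearMap.ker φ).liftQ f h)
  exact ⟨g, LinearMap.ext fun a ↦ hg (Submodule.Quotient.mk a)⟩

/-- A map to an injective module which kills `0 :_A I` lies in `I • Hom(A, E)`. -/
lemma mem_smul_top_of_torsionBySet_le_ker [IsNoetherianRing R] [Module.Injective R E] (I : Ideal R)
    (f : A →ₗ[R] E) (h : Submodule.torsionBySet R A (I : Set R) ≤ LinearMap.ker f) :
    f ∈ I • (⊤ : Submodule R (A →ₗ[R] E)) := by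
  obtain ⟨n, r, hr⟩ := Submodule.fg_iff_exists_fin_generating_family.1
    ((isNoetherianRing_iff_ideal_fg R).1 ‹_› I)
  obtain ⟨g, hg⟩ := exists_comp_eq_of_ker_le
      (LinearMap.pi fun j ↦ LinearMap.lsmul R A (r j)) f <| by
    refine le_trans (fun a ha ↦ ?_) h
    rw [← hr, ← Ideal.span, ← Submodule.torsionBySet_eq_torsionBySet_span]
    refine (Submodule.mem_torsionBySet_iff _ _).2 ?_
    rintro ⟨_, j, rfl⟩
    exact congrFun ha j
  have : f = ∑ j, r j • (g ∘ₗ LinearMap.single R (fun _ : Fin n ↦ A) j) := by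
    rw [← hg]
    refine LinearMap.ext fun a ↦ ?_
    simp only [LinearMap.comp_apply, LinearMap.sum_apply, LinearMap.smul_apply]
    rw [← Finset.univ_sum_single ((LinearMap.pi fun j ↦ LinearMap.lsmul R A (r j)) a), map_sum]
    refine Finset.sum_congr rfl fun j _ ↦ ?_
    rw [← map_smul, LinearMap.single_apply, ← Pi.single_smul]
    rfl
  rw [this]
  exact Submodule.sum_mem _ fun j _ ↦ Submodule.smul_mem_smul
    (hr ▸ Submodule.subset_span ⟨j, rfl⟩) Submodule.mem_top

/-- Nilpotent Nakayama lemma. -/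
lemma eq_top_of_top_le_sup_smul {S : Submodule R A} {J : Ideal R} {t : ℕ}
    (h : ⊤ ≤ S ⊔ J • ⊤) (ht : ∀ r ∈ J ^ t, ∀ a : A, r • a = 0) : S = ⊤ := by
  have key : ∀ k : ℕ, ⊤ ≤ S ⊔ J ^ k • (⊤ : Submodule R A) := by
    intro k
    induction k with
    | zero => simp
    | succ k ih =>
      refine ih.trans (sup_le le_sup_left ?_)
      calc J ^ k • (⊤ : Submodule R A) ≤ J ^ k • (S ⊔ J • ⊤) := smul_mono_right _ h
        _ = J ^ k • S ⊔ J ^ (k + 1) • ⊤ := by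
          rw [Submodule.smul_sup, ← Submodule.mul_smul, pow_succ]
        _ ≤ _ := sup_le_sup_right Submodule.smul_le_right _
  refine top_le_iff.1 ((key t).trans (sup_le le_rfl ?_))
  refine Submodule.smul_le.2 fun r hr a _ ↦ ?_
  rw [ht r hr a]
  exact Submodule.zero_mem _

/-- A form of the determinant trick. -/
lemma exists_pow_sub_smul_eq_zero {n : ℕ} (w : Fin n → A) (hw : Submodule.span R (Set.range w) = ⊤)
    {s : R} {I : Ideal R} (h : ∀ a : A, s • a ∈ I • (⊤ : Submodule R A)) :
    ∃ u ∈ I, ∀ a : A, (s ^ n - u) • a = 0 := by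
  have : Module.Finite R A := ⟨⟨(Set.finite_range w).toFinset, by simpa using hw⟩⟩
  obtain ⟨q, hq, hdeg, hcoeff, hq0⟩ :=
    LinearMap.exists_monic_and_natDegree_eq_and_coeff_mem_pow_and_aeval_eq_zero R
      (LinearMap.lsmul R A s) I (by rintro _ ⟨a, rfl⟩; exact h a)
  have hle : q.natDegree ≤ n := by
    rw [hdeg, ← hw]
    refine (Submodule.spanFinrank_span_le_ncard_of_finite (Set.finite_range w)).trans ?_
    rw [← Set.image_univ]
    refine (Set.ncard_image_le Set.finite_univ).trans ?_
    rw [Set.ncard_univ, Nat.card_eq_fintype_card, Fintype.card_fin]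
  have hev : ∀ a : A, q.eval s • a = 0 := fun a ↦ by
    have h1 : (Polynomial.aeval (LinearMap.lsmul R A s) q) = LinearMap.lsmul R A (q.eval s) :=
      Polynomial.aeval_algebraMap_apply_eq_algebraMap_eval (A := Module.End R A) s q
    have := LinearMap.congr_fun (h1.symm.trans hq0) a
    exact this
  have hmem : s ^ q.natDegree - q.eval s ∈ I := by
    rw [Polynomial.eval_eq_sum_range, Finset.sum_range_succ, hq.coeff_natDegree, one_mul,
      sub_add_cancel_right, neg_mem_iff]
    refine Ideal.sum_mem _ fun k hk ↦ Ideal.mul_mem_right _ _ ?_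
    exact Ideal.pow_le_self (Nat.sub_ne_zero_of_lt (Finset.mem_range.1 hk)) (hcoeff k)
  refine ⟨s ^ (n - q.natDegree) * (s ^ q.natDegree - q.eval s), Ideal.mul_mem_left _ _ hmem,
    fun a ↦ ?_⟩
  rw [mul_sub, ← pow_add, Nat.sub_add_cancel hle, sub_sub_cancel, mul_smul, hev, smul_zero]

lemma isTorsionBySet_torsionBySet (J : Ideal R) :
    Module.IsTorsionBySet R (Submodule.torsionBySet R A (J : Set R)) (J : Set R) := fun a r ↦
  Subtype.ext ((Submodule.mem_torsionBySet_iff _ _).1 a.2 r)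

lemma exists_smul_mem_socle_ne_zero {J : Ideal R} (hA : IsPowTorsion J A) {a : A} (ha : a ≠ 0) :
    ∃ r : R, r • a ≠ 0 ∧ r • a ∈ Submodule.torsionBySet R A (J : Set R) := by
  classical
  have hex := hA a
  have hmin := fun k ↦ Nat.find_min hex (m := k)
  have hspec := Nat.find_spec hex
  cases ht : Nat.find hex with
  | zero =>
    rw [ht] at hspec
    exact absurd (by simpa using hspec 1 (by simp)) ha
  | succ t =>
    have := hmin t (by omega)
    push Not at this
    obtain ⟨r, hr, hra⟩ := this
    refine ⟨r, hra, (Submodule.mem_torsionBySet_iff _ _).2 fun x ↦ ?_⟩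
    rw [smul_smul]
    rw [ht] at hspec
    exact hspec _ (by rw [pow_succ']; exact Ideal.mul_mem_mul x.2 hr)

variable [IsLocalRing R]

lemma IsInjHull.exists_ne_zero (hE : IsInjHull R (maximalIdeal R) E) {a : A} (ha : a ≠ 0) :
    ∃ φ : A →ₗ[R] E, φ a ≠ 0 := by
  obtain ⟨hinj, f, hf, -⟩ := hE
  let ψ := LinearMap.toSpanSingleton R A a
  let q : R →ₗ[R] R ⧸ maximalIdeal R := Submodule.mkQ _
  obtain ⟨φ, hφ⟩ := exists_comp_eq_of_ker_le ψ (f ∘ₗ q) <| by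
    refine le_trans (IsLocalRing.le_maximalIdeal (J := LinearMap.ker ψ) fun h ↦ ha ?_) ?_
    · have : (1 : R) ∈ LinearMap.ker ψ := h ▸ Submodule.mem_top
      simpa [ψ] using this
    · intro r hr
      have : q r = 0 := (Submodule.Quotient.mk_eq_zero _).2 hr
      simp [this]
  refine ⟨φ, fun h ↦ ?_⟩
  have h1 : f (q 1) = 0 := by
    rw [← LinearMap.comp_apply, ← hφ]
    simpa [ψ] using h
  have h2 : q 1 = 0 := hf (h1.trans (map_zero f).symm)
  exact (Ideal.ne_top_iff_one _).1 (maximalIdeal.isMaximal R).ne_top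
    ((Submodule.Quotient.mk_eq_zero _).1 h2)

lemma IsInjHull.isPowTorsion [IsNoetherianRing R] (hE : IsInjHull R (maximalIdeal R) E) :
    IsPowTorsion (maximalIdeal R) E := by
  obtain ⟨-, f, hf, hess⟩ := hE
  intro e
  let I : Ideal R := LinearMap.ker (LinearMap.toSpanSingleton R E e)
  have hI : ∀ {r}, r ∈ I ↔ r • e = 0 := Iff.rfl
  suffices h : maximalIdeal R ≤ I.radical by
    obtain ⟨n, hn⟩ := Ideal.exists_pow_le_of_le_radical_of_fg h
      ((isNoetherianRing_iff_ideal_fg R).1 ‹_› _)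
    exact ⟨n, fun r hr ↦ hI.1 (hn hr)⟩
  intro x hx
  let F : ℕ →o Ideal R := ⟨fun n ↦ LinearMap.ker (LinearMap.toSpanSingleton R E (x ^ n • e)),
    monotone_nat_of_le_succ fun n r hr ↦ by
      replace hr : r • x ^ n • e = 0 := hr
      change r • x ^ (n + 1) • e = 0
      rw [pow_succ', mul_smul, smul_comm, hr, smul_zero]⟩
  obtain ⟨n, hn⟩ := monotone_stabilizes_iff_noetherian.2 ‹_› F
  refine ⟨n, hI.2 ?_⟩
  by_contra hne
  have := hess (R ∙ (x ^ n • e)) (by simpa using hne)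
  obtain ⟨y, ⟨hy, z, hz⟩, hy0⟩ := Submodule.exists_mem_ne_zero_of_ne_bot this
  obtain ⟨r, rfl⟩ := Submodule.mem_span_singleton.1 hy
  refine hy0 ?_
  have hxz : x • z = 0 := by
    obtain ⟨c, rfl⟩ := Ideal.Quotient.mk_surjective z
    exact Ideal.Quotient.eq_zero_iff_mem.2 (Ideal.mul_mem_right c _ hx)
  have h1 : r ∈ F (n + 1) := by
    change r • x ^ (n + 1) • e = 0
    rw [pow_succ', mul_smul, smul_comm, ← hz, ← map_smul, hxz, map_zero]
  rw [← hn (n + 1) n.le_succ] at h1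
  exact h1

lemma IsInjHull.torsionBySet_le_range {f : R ⧸ maximalIdeal R →ₗ[R] E}
    (hess : ∀ N : Submodule R E, N ≠ ⊥ → N ⊓ LinearMap.range f ≠ ⊥) :
    Submodule.torsionBySet R E (maximalIdeal R : Set R) ≤ LinearMap.range f := by
  intro e he
  by_cases h0 : e = 0
  · rw [h0]; exact Submodule.zero_mem _
  obtain ⟨y, ⟨hy, hyf⟩, hy0⟩ := Submodule.exists_mem_ne_zero_of_ne_bot
    (hess (R ∙ e) (by simpa using h0))
  obtain ⟨r, rfl⟩ := Submodule.mem_span_singleton.1 hy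
  have hr : IsUnit r := by
    by_contra h
    exact hy0 ((Submodule.mem_torsionBySet_iff _ _).1 he ⟨r, h⟩)
  obtain ⟨u, rfl⟩ := hr
  have := Submodule.smul_mem _ (↑u⁻¹ : R) hyf
  rwa [smul_smul, Units.inv_mul, one_smul] at this

lemma isSemisimpleModule_of_isTorsionBySet
    (h : Module.IsTorsionBySet R A (maximalIdeal R : Set R)) : IsSemisimpleModule R A := by
  let := Ideal.Quotient.field (maximalIdeal R)
  let := h.module
  exact h.isSemisimpleModule_iff.1 inferInstance

lemma IsInjHull.isArtinian [IsNoetherianRing R] (hE : IsInjHull R (maximalIdeal R) E) :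
    IsArtinian R E := by
  refine isArtinian_of_socle hE.isPowTorsion ?_
  obtain ⟨-, f, hf, hess⟩ := hE
  have : IsSimpleModule R (R ⧸ maximalIdeal R) :=
    isSimpleModule_iff_isCoatom.2 (maximalIdeal.isMaximal R).out
  have : IsArtinian R (R ⧸ maximalIdeal R) := inferInstance
  have : IsArtinian R (LinearMap.range f) :=
    isArtinian_of_surjective _ f.rangeRestrict f.surjective_rangeRestrict
  exact isArtinian_of_injective (Submodule.inclusion (IsInjHull.torsionBySet_le_range hess))
    (Submodule.inclusion_injective _)

lemma IsInjHull.finite_hom_socle [IsNoetherianRing R] [IsArtinian R A]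
    (hE : IsInjHull R (maximalIdeal R) E) :
    Module.Finite R (Submodule.torsionBySet R A (maximalIdeal R : Set R) →ₗ[R] E) := by
  obtain ⟨-, f, hf, hess⟩ := hE
  have h := isTorsionBySet_torsionBySet (A := A) (maximalIdeal R)
  have hss := isSemisimpleModule_of_isTorsionBySet h
  have hfin : Module.Finite R (Submodule.torsionBySet R A (maximalIdeal R : Set R)) :=
    ((IsSemisimpleModule.finite_tfae (R := R)
      (M := Submodule.torsionBySet R A (maximalIdeal R : Set R))).out 0 2).2
      (inferInstance : IsArtinian R (Submodule.torsionBySet R A (maximalIdeal R : Set R)))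
  obtain ⟨n, s, hs⟩ := Module.Finite.exists_fin (R := R)
    (M := Submodule.torsionBySet R A (maximalIdeal R : Set R))
  let Φ : (Submodule.torsionBySet R A (maximalIdeal R : Set R) →ₗ[R] E) →ₗ[R]
      (Fin n → LinearMap.range f) := LinearMap.pi fun j ↦
    (LinearMap.applyₗ (s j)).codRestrict _ fun φ ↦ IsInjHull.torsionBySet_le_range hess <|
      (Submodule.mem_torsionBySet_iff _ _).2 fun r ↦ by
        change (r : R) • φ (s j) = 0
        rw [← map_smul, @h (s j) r, map_zero]
  have : IsNoetherian R (Fin n → LinearMap.range f) := inferInstance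
  refine Module.Finite.of_injective Φ fun φ ψ hφ ↦ ?_
  refine LinearMap.ext_on_range hs fun j ↦ ?_
  exact congrArg Subtype.val (congrFun hφ j)

/-- Finitely many maps to `E` restrict to generators of the dual of the socle. -/
lemma IsInjHull.exists_dual_generators [IsNoetherianRing R] [IsArtinian R A]
    (hE : IsInjHull R (maximalIdeal R) E) : ∃ (n : ℕ) (F : Fin n → A →ₗ[R] E),
      ∀ φ : A →ₗ[R] E, ∃ c : Fin n → R,
        ∀ a ∈ Submodule.torsionBySet R A (maximalIdeal R : Set R), φ a = ∑ j, c j • F j a := by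
  have := hE.1
  have := hE.finite_hom_socle (A := A)
  obtain ⟨n, s, hs⟩ := Module.Finite.exists_fin (R := R)
    (M := Submodule.torsionBySet R A (maximalIdeal R : Set R) →ₗ[R] E)
  choose F hF using fun j ↦ exists_comp_eq_of_ker_le (Submodule.subtype _) (s j)
    (by rw [Submodule.ker_subtype]; exact bot_le)
  refine ⟨n, F, fun φ ↦ ?_⟩
  obtain ⟨c, hc⟩ := Submodule.mem_span_range_iff_exists_fun R |>.1
    (hs ▸ Submodule.mem_top : φ ∘ₗ Submodule.subtype _ ∈ Submodule.span R (Set.range s))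
  refine ⟨c, fun a ha ↦ ?_⟩
  have := LinearMap.congr_fun hc ⟨a, ha⟩
  simp only [← hF] at this
  simpa using this.symm

lemma IsInjHull.exists_embedding [IsNoetherianRing R] [IsArtinian R A]
    (hE : IsInjHull R (maximalIdeal R) E) (hA : IsPowTorsion (maximalIdeal R) A) :
    ∃ (n : ℕ) (f : A →ₗ[R] (Fin n → E)), Function.Injective f := by
  obtain ⟨n, F, hF⟩ := hE.exists_dual_generators (A := A)
  refine ⟨n, LinearMap.pi F, (injective_iff_map_eq_zero _).2 fun a ha ↦ ?_⟩
  by_contra h0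
  obtain ⟨r, hr, hs⟩ := exists_smul_mem_socle_ne_zero hA h0
  obtain ⟨φ, hφ⟩ := hE.exists_ne_zero hr
  obtain ⟨c, hc⟩ := hF φ
  refine hφ ?_
  rw [hc _ hs]
  refine Finset.sum_eq_zero fun j _ ↦ ?_
  have : F j a = 0 := congrFun ha j
  rw [map_smul, this, smul_zero, smul_zero]

/-- Every element is annihilated by an element congruent modulo `p` to a fixed element outside
`p`. -/
def IsSerreSmall (p : Ideal R) (A : Type) [AddCommGroup A] [Module R A] : Prop :=
  ∃ s ∉ p, ∀ a : A, ∃ u ∈ p, (s - u) • a = 0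

lemma IsInjHull.isSerreSmall_of_smul [IsNoetherianRing R] [IsArtinian R A]
    (hE : IsInjHull R (maximalIdeal R) E) (hA : IsPowTorsion (maximalIdeal R) A) {p : Ideal R}
    [p.IsPrime] {s : R} (hs : s ∉ p) (h : ∀ a : A, (∀ r ∈ p, r • a = 0) → s • a = 0) :
    IsSerreSmall p A := by
  have := hE.1
  obtain ⟨n, F, hF⟩ := hE.exists_dual_generators (A := A)
  refine ⟨s ^ n, fun hsn ↦ hs (Ideal.IsPrime.mem_of_pow_mem ‹_› n hsn), fun a ↦ ?_⟩
  let L : Submodule R A := R ∙ a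
  obtain ⟨t, ht⟩ := hA a
  have hL : ∀ r ∈ maximalIdeal R ^ t, ∀ φ : L →ₗ[R] E, r • φ = 0 := by
    refine fun r hr φ ↦ LinearMap.ext fun ⟨b, hb⟩ ↦ ?_
    obtain ⟨c, rfl⟩ := Submodule.mem_span_singleton.1 hb
    rw [LinearMap.smul_apply, ← map_smul]
    refine (congrArg φ (Subtype.ext ?_)).trans (map_zero φ)
    change r • c • a = 0
    rw [smul_comm, ht r hr, smul_zero]
  have hspan : Submodule.span R (Set.range fun j ↦ F j ∘ₗ L.subtype) = ⊤ := by
    refine eq_top_of_top_le_sup_smul (J := maximalIdeal R) (fun φ _ ↦ ?_) hL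
    obtain ⟨ψ, rfl⟩ := exists_comp_eq_of_ker_le L.subtype φ
      (by rw [Submodule.ker_subtype]; exact bot_le)
    obtain ⟨c, hc⟩ := hF ψ
    rw [← add_sub_cancel (∑ j, c j • F j ∘ₗ L.subtype) (ψ ∘ₗ L.subtype)]
    refine Submodule.add_mem_sup (Submodule.sum_mem _ fun j _ ↦ Submodule.smul_mem _ _
      (Submodule.subset_span ⟨j, rfl⟩)) (mem_smul_top_of_torsionBySet_le_ker _ _ fun b hb ↦ ?_)
    have hb' : (b : A) ∈ Submodule.torsionBySet R A (maximalIdeal R : Set R) :=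
      (Submodule.mem_torsionBySet_iff _ _).2 fun r ↦
        congrArg Subtype.val ((Submodule.mem_torsionBySet_iff _ _).1 hb r)
    simp [hc _ hb']
  obtain ⟨u, hu, huL⟩ := exists_pow_sub_smul_eq_zero (s := s) (I := p) _ hspan fun φ ↦
    mem_smul_top_of_torsionBySet_le_ker _ _ fun b hb ↦ by
      have : s • b = 0 := Subtype.ext <| h b fun r hr ↦
        congrArg Subtype.val ((Submodule.mem_torsionBySet_iff _ _).1 hb ⟨r, hr⟩)
      rw [LinearMap.mem_ker, LinearMap.smul_apply, ← map_smul, this, map_zero]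
  refine ⟨u, hu, ?_⟩
  by_contra hne
  obtain ⟨φ, hφ⟩ := hE.exists_ne_zero hne
  refine hφ ?_
  rw [map_smul]
  exact LinearMap.congr_fun (huL (φ ∘ₗ L.subtype)) ⟨a, Submodule.mem_span_singleton_self a⟩

end Matlis

section SerreSmall

variable {R : Type} [CommRing R] {p : Ideal R} {A B C : Type} [AddCommGroup A] [Module R A]
  [AddCommGroup B] [Module R B] [AddCommGroup C] [Module R C]

namespace IsSerreSmall

lemma of_injective (hB : IsSerreSmall p B) {f : A →ₗ[R] B} (hf : Function.Injective f) :
    IsSerreSmall p A := by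
  obtain ⟨s, hs, h⟩ := hB
  refine ⟨s, hs, fun a ↦ ?_⟩
  obtain ⟨u, hu, hua⟩ := h (f a)
  exact ⟨u, hu, hf (by rw [map_smul, hua, map_zero])⟩

lemma of_surjective (hA : IsSerreSmall p A) {f : A →ₗ[R] B} (hf : Function.Surjective f) :
    IsSerreSmall p B := by
  obtain ⟨s, hs, h⟩ := hA
  refine ⟨s, hs, fun b ↦ ?_⟩
  obtain ⟨a, rfl⟩ := hf b
  obtain ⟨u, hu, hua⟩ := h a
  exact ⟨u, hu, by rw [← map_smul, hua, map_zero]⟩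

lemma of_exact [hp : p.IsPrime] {f : A →ₗ[R] B} {g : B →ₗ[R] C} (hfg : Function.Exact f g)
    (hA : IsSerreSmall p A) (hC : IsSerreSmall p C) : IsSerreSmall p B := by
  obtain ⟨s, hs, h⟩ := hA
  obtain ⟨s', hs', h'⟩ := hC
  refine ⟨s * s', fun hss ↦ (hp.mem_or_mem hss).elim hs hs', fun b ↦ ?_⟩
  obtain ⟨u', hu', hb⟩ := h' (g b)
  obtain ⟨a, ha⟩ := (hfg ((s' - u') • b)).1 (by rw [map_smul, hb])
  obtain ⟨u, hu, hua⟩ := h a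
  refine ⟨s * u' + u * (s' - u'), p.add_mem (p.mul_mem_left _ hu') (p.mul_mem_right _ hu), ?_⟩
  rw [show s * s' - (s * u' + u * (s' - u')) = (s - u) * (s' - u') by ring, mul_smul, ← ha,
    ← map_smul, hua, map_zero]

lemma of_smul_eq_zero {s : R} (hs : s ∉ p) (h : ∀ a : A, s • a = 0) : IsSerreSmall p A :=
  ⟨s, hs, fun a ↦ ⟨0, p.zero_mem, by rw [sub_zero, h]⟩⟩

lemma of_subsingleton [hp : p.IsPrime] [Subsingleton A] : IsSerreSmall p A :=
  of_smul_eq_zero ((Ideal.ne_top_iff_one p).1 hp.ne_top) fun _ ↦ Subsingleton.elim _ _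

lemma subsingleton [IsLocalRing R] (h : IsSerreSmall (maximalIdeal R) A) : Subsingleton A := by
  obtain ⟨s, hs, h⟩ := h
  refine subsingleton_of_forall_eq 0 fun a ↦ ?_
  obtain ⟨u, hu, hua⟩ := h a
  have hsu : s - u ∉ maximalIdeal R := fun hm ↦ hs (by simpa using Ideal.add_mem _ hm hu)
  exact (IsLocalRing.notMem_maximalIdeal.1 hsu).smul_eq_zero.1 hua

end IsSerreSmall

end SerreSmall

section Vanishing

variable {R : Type} [CommRing R]

lemma lcMap_injective_of_equiv (J : Ideal R) (i : ℕ) {N N' : Type} [AddCommGroup N] [Module R N]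
    [AddCommGroup N'] [Module R N'] (e : N ≃ₗ[R] N') :
    Function.Injective (lcMap J i e.toLinearMap) := by
  refine Function.LeftInverse.injective (g := lcMap J i e.symm.toLinearMap) fun a ↦ ?_
  rw [← LinearMap.comp_apply, ← lcMap_comp, LinearEquiv.comp_coe, LinearEquiv.self_trans_symm,
    LinearEquiv.refl_toLinearMap, lcMap_id, LinearMap.id_apply]

lemma lc_smul_eq_zero (J : Ideal R) (i : ℕ) {N : Type} [AddCommGroup N] [Module R N] {s : R}
    (h : ∀ n : N, s • n = 0) (a : LCoh J i N) : s • a = 0 := by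
  have h0 : s • (LinearMap.id : N →ₗ[R] N) = 0 := LinearMap.ext h
  have h1 := congrArg (fun f ↦ lcMap J i f a) h0
  have h2 : lcMap J i (0 : N →ₗ[R] N) = 0 := by
    rw [← zero_smul R (0 : N →ₗ[R] N), lcMap_smul, zero_smul]
  rwa [lcMap_smul, lcMap_id, h2] at h1

lemma lc_subsingleton_of_subsingleton (J : Ideal R) (i : ℕ) {N : Type} [AddCommGroup N] [Module R N]
    [Subsingleton N] : Subsingleton (LCoh J i N) :=
  subsingleton_of_forall_eq 0 fun a ↦ by
    rw [← one_smul R a, lc_smul_eq_zero J i (fun _ ↦ Subsingleton.elim _ _)]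

section MulQuotient

variable (q : Ideal R) [hq : q.IsPrime] {x : R}

lemma lsmul_quotient_injective (hx : x ∉ q) :
    Function.Injective (LinearMap.lsmul R (R ⧸ q) x) := by
  refine (injective_iff_map_eq_zero _).2 fun y hy ↦ ?_
  obtain ⟨y, rfl⟩ := Ideal.Quotient.mk_surjective y
  have : x * y ∈ q := Ideal.Quotient.eq_zero_iff_mem.1 hy
  exact Ideal.Quotient.eq_zero_iff_mem.2 ((hq.mem_or_mem this).resolve_left hx)

/-- Multiplication by `x` on `H^i(R ⧸ q)`. -/
lemma lcMap_lsmul (J : Ideal R) (i : ℕ) (N : Type) [AddCommGroup N] [Module R N] (x : R) :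
    lcMap J i (LinearMap.lsmul R N x) = LinearMap.lsmul R (LCoh J i N) x := by
  have : LinearMap.lsmul R N x = x • LinearMap.id := rfl
  rw [this, lcMap_smul, lcMap_id]
  rfl

lemma lc_zero_lsmul_injective (J : Ideal R) (hx : x ∉ q) :
    Function.Injective (LinearMap.lsmul R (LCoh J 0 (R ⧸ q)) x) := by
  rw [← lcMap_lsmul]
  exact lcMap_zero_injective (lsmul_quotient_injective q hx)

lemma exists_surjective_ker_lsmul (J : Ideal R) (i : ℕ) (hx : x ∉ q) :
    ∃ δ : LCoh J i (R ⧸ (q ⊔ Ideal.span {x})) →ₗ[R]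
      LinearMap.ker (LinearMap.lsmul R (LCoh J (i + 1) (R ⧸ q)) x), Function.Surjective δ := by
  let g : R ⧸ q →ₗ[R] R ⧸ (q ⊔ Ideal.span {x}) := Submodule.factor le_sup_left
  have hg : Function.Surjective g := Submodule.factor_surjective _
  obtain ⟨δ, -, hδ⟩ := exists_connecting (J := J) i (lsmul_quotient_injective q hx) hg <| by
    intro y
    obtain ⟨y, rfl⟩ := Ideal.Quotient.mk_surjective y
    have h1 : g (Ideal.Quotient.mk q y) = Ideal.Quotient.mk _ y := rfl
    rw [h1, Ideal.Quotient.eq_zero_iff_mem, Submodule.mem_sup]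
    constructor
    · rintro ⟨a, ha, b, hb, rfl⟩
      obtain ⟨c, rfl⟩ := Ideal.mem_span_singleton'.1 hb
      refine ⟨Ideal.Quotient.mk q c, ?_⟩
      change Ideal.Quotient.mk q (x * c) = _
      rw [map_add, Ideal.Quotient.eq_zero_iff_mem.2 ha, zero_add, mul_comm]
    · rintro ⟨c, hc⟩
      obtain ⟨c, rfl⟩ := Ideal.Quotient.mk_surjective c
      replace hc : Ideal.Quotient.mk q (x * c) = Ideal.Quotient.mk q y := hc
      refine ⟨y - x * c, ?_, x * c, Ideal.mul_mem_right _ _ (Ideal.mem_span_singleton_self x),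
        sub_add_cancel _ _⟩
      exact Ideal.Quotient.eq.1 hc.symm
  rw [lcMap_lsmul] at hδ
  refine ⟨δ.codRestrict _ fun a ↦ hδ.apply_apply_eq_zero a, fun ⟨b, hb⟩ ↦ ?_⟩
  obtain ⟨a, rfl⟩ := (hδ b).1 hb
  exact ⟨a, rfl⟩

end MulQuotient

lemma isArtinian_of_exact {A B C : Type} [AddCommGroup A] [Module R A] [AddCommGroup B] [Module R B]
    [AddCommGroup C] [Module R C] {f : A →ₗ[R] B} {g : B →ₗ[R] C} (hfg : Function.Exact f g)
    (hA : IsArtinian R A) (hC : IsArtinian R C) : IsArtinian R B :=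
  isArtinian_of_range_eq_ker f g hfg.linearMap_ker_eq.symm

lemma isPowTorsion_quotient (J : Ideal R) : IsPowTorsion J (R ⧸ J) :=
  fun a ↦ ⟨1, fun r hr ↦ by
    obtain ⟨a, rfl⟩ := Ideal.Quotient.mk_surjective a
    rw [pow_one] at hr
    exact Ideal.Quotient.eq_zero_iff_mem.2 (J.mul_mem_right a hr)⟩

variable [IsLocalRing R]

lemma isArtinian_quotient_maximalIdeal : IsArtinian R (R ⧸ maximalIdeal R) :=
  have : IsSimpleModule R (R ⧸ maximalIdeal R) :=
    isSimpleModule_iff_isCoatom.2 (maximalIdeal.isMaximal R).out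
  inferInstance

variable [IsNoetherianRing R] {E : Type} [AddCommGroup E] [Module R E]

lemma IsInjHull.lc_subsingleton_of_isArtinian (hE : IsInjHull R (maximalIdeal R) E) (i : ℕ)
    (N : Type) [AddCommGroup N] [Module R N] [IsArtinian R N]
    (hN : IsPowTorsion (maximalIdeal R) N) : Subsingleton (LCoh (maximalIdeal R) (i + 1) N) := by
  induction i generalizing N with
  | zero =>
    obtain ⟨n, f, hf⟩ := hE.exists_embedding hN
    have := hE.1
    have hinj : Module.Injective R (Fin n → E) := .pi R _
    have hsub : Subsingleton (LCoh (maximalIdeal R) (0 + 1) (Fin n → E)) :=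
      lc_subsingleton_of_injective 0
    have hg := Submodule.mkQ_surjective (LinearMap.range f)
    obtain ⟨δ, h1, h2⟩ := exists_connecting (J := maximalIdeal R) 0 hf hg
      (LinearMap.exact_map_mkQ_range f)
    refine subsingleton_of_forall_eq 0 fun a ↦ ?_
    obtain ⟨b, rfl⟩ := (h2 a).1 (Subsingleton.elim _ _)
    obtain ⟨c, rfl⟩ := lc_zero_surjective hg hE.isPowTorsion.pi b
    exact h1.apply_apply_eq_zero c
  | succ i ih =>
    obtain ⟨n, f, hf⟩ := hE.exists_embedding hN
    have := hE.1
    have := hE.isArtinian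
    have hinj : Module.Injective R (Fin n → E) := .pi R _
    have hsub : Subsingleton (LCoh (maximalIdeal R) (i + 1 + 1) (Fin n → E)) :=
      lc_subsingleton_of_injective (i + 1)
    have hg := Submodule.mkQ_surjective (LinearMap.range f)
    obtain ⟨δ, h1, h2⟩ := exists_connecting (J := maximalIdeal R) (i + 1) hf hg
      (LinearMap.exact_map_mkQ_range f)
    have := ih _ (hE.isPowTorsion.pi.of_surjective hg)
    refine subsingleton_of_forall_eq 0 fun a ↦ ?_
    obtain ⟨b, rfl⟩ := (h2 a).1 (Subsingleton.elim _ _)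
    rw [Subsingleton.elim b 0, map_zero]

lemma IsInjHull.lc_isArtinian_of_quotient (hE : IsInjHull R (maximalIdeal R) E) (i : ℕ)
    (h : ∀ q : Ideal R, q.IsPrime → ¬ (maximalIdeal R : Set R) ⊆ q →
      IsArtinian R (LCoh (maximalIdeal R) i (R ⧸ q)))
    (N : Type) [AddCommGroup N] [Module R N] [hN : Module.Finite R N] :
    IsArtinian R (LCoh (maximalIdeal R) i N) := by
  induction hN using IsNoetherianRing.induction_on_isQuotientEquivQuotientPrime R with
  | subsingleton N =>
    have := lc_subsingleton_of_subsingleton (maximalIdeal R) i (N := N)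
    exact isArtinian_of_finite
  | exact N₁ N₂ N₃ f g hf hg hfg h₁ h₃ => exact isArtinian_of_exact (lcMap_exact hf hg hfg) h₁ h₃
  | quotient N q e =>
    have : IsArtinian R (LCoh (maximalIdeal R) i (R ⧸ q.asIdeal)) := by
      by_cases hq : (maximalIdeal R : Set R) ⊆ q.asIdeal
      · rw [← (maximalIdeal.isMaximal R).eq_of_le q.2.ne_top hq]
        have := isArtinian_quotient_maximalIdeal (R := R)
        cases i with
        | zero =>
          obtain ⟨φ, hφ⟩ := exists_lc_zero_embedding (maximalIdeal R) (R ⧸ maximalIdeal R)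
          exact isArtinian_of_injective φ hφ
        | succ i =>
          have := hE.lc_subsingleton_of_isArtinian i _ (isPowTorsion_quotient (maximalIdeal R))
          exact isArtinian_of_finite
      · exact h _ q.2 hq
    exact isArtinian_of_injective _ (lcMap_injective_of_equiv _ i e)

lemma IsInjHull.lc_isArtinian (hE : IsInjHull R (maximalIdeal R) E) (i : ℕ) (N : Type)
    [AddCommGroup N] [Module R N] [hN : Module.Finite R N] :
    IsArtinian R (LCoh (maximalIdeal R) i N) := by
  induction i generalizing N with
  | zero =>
    refine hE.lc_isArtinian_of_quotient _ (fun q hq hqm ↦ ?_) N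
    obtain ⟨x, hx, hxq⟩ := Set.not_subset.1 hqm
    refine isArtinian_of_ker_smul x (fun a ↦ ?_) ?_
    · obtain ⟨t, ht⟩ := lc_torsion a
      exact ⟨t, ht _ (Ideal.pow_mem_pow hx t)⟩
    · rw [LinearMap.ker_eq_bot.2 (lc_zero_lsmul_injective q _ hxq)]
      infer_instance
  | succ i ih =>
    refine hE.lc_isArtinian_of_quotient _ (fun q hq hqm ↦ ?_) N
    obtain ⟨x, hx, hxq⟩ := Set.not_subset.1 hqm
    refine isArtinian_of_ker_smul x (fun a ↦ ?_) ?_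
    · obtain ⟨t, ht⟩ := lc_torsion a
      exact ⟨t, ht _ (Ideal.pow_mem_pow hx t)⟩
    · obtain ⟨δ, hδ⟩ := exists_surjective_ker_lsmul q (maximalIdeal R) i hxq
      have := ih (R ⧸ (q ⊔ Ideal.span {x}))
      exact isArtinian_of_surjective _ δ hδ

end Vanishing

section ChainBound

variable {R : Type} [CommRing R]

/-- Chains of primes below `p` in the support of `N` have length at most `h`. -/
def ChainBound (p : PrimeSpectrum R) (N : Type) [AddCommGroup N] [Module R N] (h : ℕ) : Prop :=
  ∀ l : LTSeries (PrimeSpectrum R), (∀ i, l i ∈ Module.support R N) → l.last ≤ p → l.length ≤ h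

lemma ChainBound.mono {p : PrimeSpectrum R} {N N' : Type} [AddCommGroup N] [Module R N]
    [AddCommGroup N'] [Module R N'] {h : ℕ} (hN : ChainBound p N h)
    (hNN : Module.support R N' ⊆ Module.support R N) : ChainBound p N' h :=
  fun l hl ↦ hN l fun i ↦ hNN (hl i)

lemma mem_support_quotient {p : PrimeSpectrum R} {I : Ideal R} :
    p ∈ Module.support R (R ⧸ I) ↔ I ≤ p.asIdeal := by
  rw [Module.mem_support_iff_of_finite, Ideal.annihilator_quotient]

lemma ChainBound.quotient_sup_span {p q : PrimeSpectrum R} {h : ℕ}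
    (hq : ChainBound p (R ⧸ q.asIdeal) h) {x : R} (hxq : x ∉ q.asIdeal)
    (l : LTSeries (PrimeSpectrum R))
    (hl : ∀ i, l i ∈ Module.support R (R ⧸ (q.asIdeal ⊔ Ideal.span {x})))
    (hlp : l.last ≤ p) : l.length + 1 ≤ h := by
  have hlt : q < l.head := by
    have := mem_support_quotient.1 (hl 0)
    refine lt_of_le_of_ne (le_sup_left.trans this) fun hq ↦ hxq ?_
    rw [hq]
    exact this (Ideal.mem_sup_right (Ideal.mem_span_singleton_self x))
  have hlen : (l.cons q hlt).length = l.length + 1 :=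
    (RelSeries.append_length _ _ _).trans (congrArg (· + 1) (zero_add _))
  rw [← hlen]
  refine hq _ (fun i ↦ mem_support_quotient.2 ?_) ?_
  · exact (LTSeries.monotone (l.cons q hlt) (Fin.zero_le i) :)
  · rwa [RelSeries.last_cons]

variable [IsLocalRing R] [IsNoetherianRing R] {E : Type} [AddCommGroup E] [Module R E]

lemma isSerreSmall_lc_of_quotient {p : PrimeSpectrum R} {h i : ℕ}
    (H : ∀ q : PrimeSpectrum R, q ≤ p → ChainBound p (R ⧸ q.asIdeal) h →
      IsSerreSmall p.asIdeal (LCoh (maximalIdeal R) i (R ⧸ q.asIdeal)))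
    (N : Type) [AddCommGroup N] [Module R N] [hN : Module.Finite R N] (hb : ChainBound p N h) :
    IsSerreSmall p.asIdeal (LCoh (maximalIdeal R) i N) := by
  induction hN using IsNoetherianRing.induction_on_isQuotientEquivQuotientPrime R with
  | subsingleton N =>
    have := lc_subsingleton_of_subsingleton (maximalIdeal R) i (N := N)
    exact .of_subsingleton
  | exact N₁ N₂ N₃ f g hf hg hfg h₁ h₃ =>
    have hs := Module.support_of_exact hfg hf hg
    exact .of_exact (lcMap_exact hf hg hfg) (h₁ (hb.mono (hs ▸ Set.subset_union_left)))
      (h₃ (hb.mono (hs ▸ Set.subset_union_right)))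
  | quotient N q e =>
    by_cases hq : q ≤ p
    · exact (H q hq (hb.mono e.support_eq.symm.subset)).of_injective
        (lcMap_injective_of_equiv _ i e)
    · obtain ⟨s, hsq, hsp⟩ := Set.not_subset.1 hq
      refine .of_smul_eq_zero hsp (lc_smul_eq_zero _ i fun n ↦ e.injective ?_)
      obtain ⟨a, ha⟩ := Ideal.Quotient.mk_surjective (e n)
      rw [map_smul, map_zero, ← ha]
      exact Ideal.Quotient.eq_zero_iff_mem.2 (q.asIdeal.mul_mem_right a hsq)

lemma IsInjHull.isSerreSmall_lc (hE : IsInjHull R (maximalIdeal R) E) {p : PrimeSpectrum R}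
    {c : ℕ} (hc : ∀ i, c < i → Subsingleton (LCoh (maximalIdeal R) i (R ⧸ p.asIdeal)))
    (h i : ℕ) (hi : h + c < i) (N : Type) [AddCommGroup N] [Module R N] [Module.Finite R N]
    (hb : ChainBound p N h) : IsSerreSmall p.asIdeal (LCoh (maximalIdeal R) i N) := by
  induction h using Nat.strong_induction_on generalizing i N with
  | _ h ih =>
  refine isSerreSmall_lc_of_quotient (fun q hqp hbq ↦ ?_) N hb
  rcases hqp.eq_or_lt with rfl | hlt
  · have := hc i (by omega)
    exact .of_subsingleton
  obtain ⟨x, hxp, hxq⟩ := Set.exists_of_ssubset hlt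
  have hb' := hbq.quotient_sup_span hxq
  have hh : 0 < h := hb' (RelSeries.singleton _ p) (fun _ ↦ mem_support_quotient.2
    (sup_le hqp ((Ideal.span_singleton_le_iff_mem _).2 hxp))) le_rfl
  obtain ⟨i, rfl⟩ := Nat.exists_eq_add_one.2 (Nat.zero_lt_of_lt hi)
  obtain ⟨δ, hδ⟩ := exists_surjective_ker_lsmul q.asIdeal (maximalIdeal R) i hxq
  obtain ⟨s, hs, hsker⟩ := (ih (h - 1) (by omega) i (by omega) (R ⧸ (q.asIdeal ⊔ Ideal.span {x}))
    fun l hl hlp ↦ Nat.le_sub_one_of_lt (hb' l hl hlp)).of_surjective hδ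
  have := hE.lc_isArtinian (i + 1) (R ⧸ q.asIdeal)
  refine hE.isSerreSmall_of_smul lc_torsion hs fun a ha ↦ ?_
  obtain ⟨u, hu, hua⟩ := hsker ⟨a, ha x hxp⟩
  have hua' : (s - u) • a = 0 := congrArg Subtype.val hua
  rwa [sub_smul, ha u hu, sub_zero] at hua'

lemma IsInjHull.lc_subsingleton (hE : IsInjHull R (maximalIdeal R) E) {h i : ℕ} (hi : h < i)
    (N : Type) [AddCommGroup N] [Module R N] [Module.Finite R N]
    (hb : ChainBound (closedPoint R) N h) : Subsingleton (LCoh (maximalIdeal R) i N) := by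
  refine (hE.isSerreSmall_lc (p := closedPoint R) (c := 0) (fun j hj ↦ ?_) h i hi N hb).subsingleton
  obtain ⟨j, rfl⟩ := Nat.exists_eq_add_one.2 hj
  have := isArtinian_quotient_maximalIdeal (R := R)
  exact hE.lc_subsingleton_of_isArtinian j (R ⧸ maximalIdeal R)
    (isPowTorsion_quotient (maximalIdeal R))

end ChainBound

section LocalizedSupport

variable {R : Type} [CommRing R] {N : Type} [AddCommGroup N] [Module R N] {p : PrimeSpectrum R}

lemma mem_support_localizedModule_iff (q : PrimeSpectrum (Localization.AtPrime p.asIdeal)) :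
    q ∈ Module.support (Localization.AtPrime p.asIdeal)
        (LocalizedModule p.asIdeal.primeCompl N) ↔
      PrimeSpectrum.comap (algebraMap R (Localization.AtPrime p.asIdeal)) q ∈
        Module.support R N := by
  rw [← not_iff_not, Module.notMem_support_iff', Module.notMem_support_iff']
  constructor
  · intro h n
    obtain ⟨r, hr, hrn⟩ := h (LocalizedModule.mk n 1)
    obtain ⟨⟨r', s⟩, hrs⟩ := IsLocalization.surj p.asIdeal.primeCompl r
    have hunit (t : p.asIdeal.primeCompl) :
        algebraMap R (Localization.AtPrime p.asIdeal) t ∉ q.asIdeal := fun ht ↦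
      q.2.ne_top (Ideal.eq_top_of_isUnit_mem _ ht (IsLocalization.map_units _ t))
    have h0 : LocalizedModule.mk (r' • n) (1 : p.asIdeal.primeCompl) = 0 := by
      rw [← LocalizedModule.smul'_mk, ← algebraMap_smul (Localization.AtPrime p.asIdeal), ← hrs,
        mul_comm, mul_smul, hrn, smul_zero]
    rw [← LocalizedModule.zero_mk 1, LocalizedModule.mk_eq] at h0
    obtain ⟨t, ht⟩ := h0
    refine ⟨t * r', fun hmem ↦ ?_, by simpa [Submonoid.smul_def, smul_smul] using ht⟩
    replace hmem : algebraMap R (Localization.AtPrime p.asIdeal) (t * r') ∈ q.asIdeal := hmem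
    rw [map_mul, ← hrs] at hmem
    exact (q.2.mem_or_mem hmem).elim (hunit t) fun h ↦ (q.2.mem_or_mem h).elim hr (hunit s)
  · intro h n
    induction n using LocalizedModule.induction_on with
    | h n s =>
      obtain ⟨r, hr, hrn⟩ := h n
      refine ⟨algebraMap _ _ r, hr, ?_⟩
      rw [algebraMap_smul, LocalizedModule.smul'_mk, hrn, LocalizedModule.zero_mk]

lemma htM_eq_height (hp : p ∈ Module.support R N) :
    htM R N p = Order.height (⟨p, hp⟩ : Module.support R N) := by
  rw [Order.height_eq_krullDim_Iic]
  refine Order.krullDim_eq_of_orderIso ?_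
  let e := IsLocalization.AtPrime.primeSpectrumOrderIso (Localization.AtPrime p.asIdeal) p.asIdeal
  have he : ∀ q, (e q : PrimeSpectrum R) =
    PrimeSpectrum.comap (algebraMap R (Localization.AtPrime p.asIdeal)) q := fun q ↦ rfl
  refine
    { toFun := fun q ↦ ⟨⟨e q, (mem_support_localizedModule_iff q.1).1 q.2⟩, (e q).2⟩
      invFun := fun q ↦ ⟨e.symm ⟨q.1.1, q.2⟩, (mem_support_localizedModule_iff _).2 ?_⟩
      left_inv := fun q ↦ Subtype.ext (e.symm_apply_apply _)
      right_inv := fun q ↦ Subtype.ext (Subtype.ext (by simp only [e.apply_symm_apply]))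
      map_rel_iff' := fun {q q'} ↦ e.le_iff_le }
  rw [← he, e.apply_symm_apply]
  exact q.1.2

end LocalizedSupport

section CanonicalModule

variable {R : Type} [CommRing R] {N W E : Type} [AddCommGroup N] [Module R N] [AddCommGroup W]
  [Module R W] [AddCommGroup E] [Module R E]

lemma chainBound_of_height_le {p : PrimeSpectrum R} (hp : p ∈ Module.support R N) {h : ℕ}
    (hh : Order.height (⟨p, hp⟩ : Module.support R N) ≤ h) : ChainBound p N h := fun l hl hlp ↦ by
  let l' : LTSeries (Module.support R N) :=
    { length := l.length, toFun := fun i ↦ ⟨l i, hl i⟩, step := l.step }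
  exact_mod_cast (Order.length_le_height (p := l') hlp).trans hh

lemma chainBound_of_coheight_le [Module.Finite R N] [IsLocalRing R] {p : PrimeSpectrum R}
    (hp : p ∈ Module.support R N) {c : ℕ}
    (hc : Order.coheight (⟨p, hp⟩ : Module.support R N) ≤ c) :
    ChainBound (closedPoint R) (R ⧸ p.asIdeal) c := fun l hl _ ↦ by
  have hpl (i) : p ≤ l i := mem_support_quotient.1 (hl i)
  let l' : LTSeries (Module.support R N) :=
    { length := l.length, toFun := fun i ↦ ⟨l i, Module.mem_support_mono (hpl i) hp⟩,
      step := l.step }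
  exact_mod_cast (Order.length_le_coheight (p := l') (hpl 0)).trans hc

lemma chainBound_of_krullDim_le {p : PrimeSpectrum R} {d : ℕ} (hd : mdim R N ≤ d) :
    ChainBound p N d := fun l hl _ ↦ by
  let l' : LTSeries (Module.support R N) :=
    { length := l.length, toFun := fun i ↦ ⟨l i, hl i⟩, step := l.step }
  exact_mod_cast (Order.LTSeries.length_le_krullDim l').trans hd

lemma support_subset_of_forall_smul_eq_zero [Module.Finite R N] [Module.Finite R W]
    (h : ∀ r : R, (∀ n : N, r • n = 0) → ∀ w : W, r • w = 0) :
    Module.support R W ⊆ Module.support R N := fun p hp ↦ by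
  rw [Module.mem_support_iff_of_finite] at hp ⊢
  exact fun r hr ↦ hp (Module.mem_annihilator.2 (h r (Module.mem_annihilator.1 hr)))

variable [IsLocalRing R]

lemma IsInjHull.smul_eq_zero_of_hom (hE : IsInjHull R (maximalIdeal R) E) {r : R}
    (h : ∀ φ : W →ₗ[R] E, r • φ = 0) (w : W) : r • w = 0 := by
  by_contra hw
  obtain ⟨φ, hφ⟩ := hE.exists_ne_zero hw
  exact hφ (by rw [map_smul, ← LinearMap.smul_apply, h, LinearMap.zero_apply])

lemma IsInjHull.support_subset_of_dual (hE : IsInjHull R (maximalIdeal R) E) [Module.Finite R N]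
    [Module.Finite R W] {d : ℕ} (e : (W →ₗ[R] E) ≃ₗ[R] LCoh (maximalIdeal R) d N) :
    Module.support R W ⊆ Module.support R N :=
  support_subset_of_forall_smul_eq_zero fun r hr ↦ hE.smul_eq_zero_of_hom fun φ ↦
    e.injective (by rw [map_smul, map_zero, lc_smul_eq_zero _ _ hr])

lemma IsInjHull.notMem_support_of_isSerreSmall (hE : IsInjHull R (maximalIdeal R) E)
    [Module.Finite R W] {p : PrimeSpectrum R} (h : IsSerreSmall p.asIdeal (W →ₗ[R] E)) :
    p ∉ Module.support R W := by
  obtain ⟨s, hs, h⟩ := h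
  obtain ⟨n, w, hw⟩ := Module.Finite.exists_fin (R := R) (M := W)
  have hsW (a : W) : s • a ∈ p.asIdeal • (⊤ : Submodule R W) := by
    rw [← Submodule.Quotient.mk_eq_zero, Submodule.Quotient.mk_smul]
    refine hE.smul_eq_zero_of_hom (fun φ ↦ ?_) _
    refine LinearMap.ext fun x ↦ ?_
    obtain ⟨x, rfl⟩ := Submodule.Quotient.mk_surjective _ x
    obtain ⟨u, hu, hφ⟩ := h (φ ∘ₗ Submodule.mkQ _)
    have hux : φ (u • Submodule.Quotient.mk x) = 0 := by
      rw [← Submodule.Quotient.mk_smul, (Submodule.Quotient.mk_eq_zero _).2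
        (Submodule.smul_mem_smul hu Submodule.mem_top), map_zero]
    have := LinearMap.congr_fun hφ x
    rw [sub_smul, LinearMap.sub_apply, LinearMap.smul_apply, LinearMap.smul_apply,
      LinearMap.zero_apply, LinearMap.comp_apply, ← map_smul φ u, Submodule.mkQ_apply, hux,
      sub_zero] at this
    exact this
  obtain ⟨u, hu, hua⟩ := exists_pow_sub_smul_eq_zero w hw hsW
  rw [Module.mem_support_iff_of_finite]
  intro hp
  have := p.asIdeal.add_mem (hp (Module.mem_annihilator.2 hua)) hu
  rw [sub_add_cancel] at this
  exact hs (p.2.mem_of_pow_mem n this)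

variable [IsNoetherianRing R]

lemma IsInjHull.lcMap_mkQ_injective (hE : IsInjHull R (maximalIdeal R) E) [Module.Finite R N]
    {d : ℕ} (hd : mdim R N ≤ d) {I : Ideal R}
    (hI : ∀ r ∈ I, ∀ a : LCoh (maximalIdeal R) d N, r • a = 0) :
    Function.Injective (lcMap (maximalIdeal R) d (I • (⊤ : Submodule R N)).mkQ) := by
  let L := I • (⊤ : Submodule R N)
  obtain ⟨n, r, hr⟩ := Submodule.fg_iff_exists_fin_generating_family.1
    ((isNoetherianRing_iff_ideal_fg R).1 ‹_› I)
  have hrI (j) : r j ∈ I := hr ▸ Submodule.subset_span ⟨j, rfl⟩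
  let Φ : (Fin n → N) →ₗ[R] N := ∑ j, r j • LinearMap.proj j
  have hΦ : ∀ x, Φ x ∈ L := fun x ↦ by
    simp only [Φ, LinearMap.sum_apply]
    exact Submodule.sum_mem _ fun j _ ↦ Submodule.smul_mem_smul (hrI j) Submodule.mem_top
  let Ψ : (Fin n → N) →ₗ[R] L := Φ.codRestrict L hΦ
  have hΨ : Function.Surjective Ψ := by
    rintro ⟨y, hy⟩
    suffices L ≤ LinearMap.range Φ by
      obtain ⟨x, hx⟩ := this hy
      exact ⟨x, Subtype.ext hx⟩
    refine Submodule.smul_le.2 fun s hs y _ ↦ ?_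
    rw [← hr] at hs
    obtain ⟨c, rfl⟩ := (Submodule.mem_span_range_iff_exists_fun R).1 hs
    refine ⟨fun j ↦ c j • y, ?_⟩
    simp only [Φ, LinearMap.sum_apply, LinearMap.smul_apply, LinearMap.proj_apply, smul_smul,
      Finset.sum_smul, smul_eq_mul, mul_comm]
  obtain ⟨δ, hδ, -⟩ := exists_connecting (J := maximalIdeal R) d
    (Submodule.subtype_injective (LinearMap.ker Ψ)) hΨ (LinearMap.exact_subtype_ker_map Ψ)
  have hsupp : Module.support R (LinearMap.ker Ψ) ⊆ Module.support R N := by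
    refine support_subset_of_forall_smul_eq_zero fun s hs x ↦ Subtype.ext (funext fun j ↦ hs _)
  have := hE.lc_subsingleton (Nat.lt_succ_self d) (LinearMap.ker Ψ)
    ((chainBound_of_krullDim_le hd).mono hsupp)
  have hΦ0 (s : Finset (Fin n)) (b) :
      lcMap (maximalIdeal R) d (∑ j ∈ s, r j • (LinearMap.proj j : (Fin n → N) →ₗ[R] N)) b = 0 := by
    induction s using Finset.cons_induction with
    | empty => rw [Finset.sum_empty, ← zero_smul R (0 : (Fin n → N) →ₗ[R] N), lcMap_smul, zero_smul,
        LinearMap.zero_apply]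
    | cons j s hj ih =>
      rw [Finset.sum_cons, lcMap_add, LinearMap.add_apply, ih, add_zero, lcMap_smul]
      exact hI _ (hrI j) _
  have hzero : lcMap (maximalIdeal R) d L.subtype = 0 := by
    ext a
    obtain ⟨b, rfl⟩ := (hδ a).1 (Subsingleton.elim _ _)
    have hcomp : L.subtype ∘ₗ Ψ = Φ := LinearMap.subtype_comp_codRestrict _ _ _
    rw [← LinearMap.comp_apply, ← lcMap_comp, hcomp]
    exact hΦ0 _ b
  refine (injective_iff_map_eq_zero _).2 fun a ha ↦ ?_
  obtain ⟨b, rfl⟩ := (lcMap_exact L.subtype_injective L.mkQ_surjective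
    (LinearMap.exact_subtype_mkQ L) a).1 ha
  rw [hzero, LinearMap.zero_apply]

/-- `W` and `N` have the same height at each prime of the support of `W` if the Matlis dual of `W`
is the top local cohomology of `N`. -/
lemma IsInjHull.height_eq_of_dual (hE : IsInjHull R (maximalIdeal R) E) [Module.Finite R N]
    [Module.Finite R W] {d : ℕ} (hd : mdim R N = d)
    (e : (W →ₗ[R] E) ≃ₗ[R] LCoh (maximalIdeal R) d N) {p : PrimeSpectrum R}
    (hp : p ∈ Module.support R W) :
    Order.height (⟨p, hp⟩ : Module.support R W) =
      Order.height (⟨p, hE.support_subset_of_dual e hp⟩ : Module.support R N) := by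
  have hsub := hE.support_subset_of_dual e
  have hpN := hsub hp
  have hle : Order.height (⟨p, hp⟩ : Module.support R W) ≤
      Order.height (⟨p, hpN⟩ : Module.support R N) :=
    Order.height_le_height_apply_of_strictMono (Set.inclusion hsub) (fun _ _ h ↦ h) _
  refine hle.antisymm ?_
  have : Nonempty (Module.support R N) := ⟨⟨p, hpN⟩⟩
  have hsum : Order.height (⟨p, hpN⟩ : Module.support R N) +
      Order.coheight (⟨p, hpN⟩ : Module.support R N) ≤ d := by
    have h := hd
    rw [mdim, Order.krullDim_eq_iSup_height_add_coheight_of_nonempty] at h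
    have h' : (⨆ a : Module.support R N, Order.height a + Order.coheight a) = (d : ℕ∞) := by
      exact_mod_cast h
    exact h' ▸ le_iSup (fun a : Module.support R N ↦ Order.height a + Order.coheight a) ⟨p, hpN⟩
  obtain ⟨hN, hhN⟩ := ENat.ne_top_iff_exists.1
    (ne_top_of_le_ne_top (ENat.natCast_ne_top d) (le_self_add.trans hsum))
  obtain ⟨c, hc⟩ := ENat.ne_top_iff_exists.1
    (ne_top_of_le_ne_top (ENat.natCast_ne_top d) (le_add_self.trans hsum))
  obtain ⟨h, hh⟩ := ENat.ne_top_iff_exists.1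
    (ne_top_of_le_ne_top (hhN ▸ ENat.natCast_ne_top hN) hle)
  rw [← hhN, ← hc] at hsum
  rw [← hh, ← hhN]
  norm_cast at hsum ⊢
  by_contra! hlt
  let I := Module.annihilator R W
  have hI : ∀ r ∈ I, ∀ a : LCoh (maximalIdeal R) d N, r • a = 0 := fun r hr a ↦ by
    obtain ⟨φ, rfl⟩ := e.surjective a
    rw [← map_smul, ← map_zero e]
    congr 1
    ext w
    rw [LinearMap.smul_apply, ← map_smul, Module.mem_annihilator.1 hr, map_zero]
    rfl
  have hsupp : Module.support R (N ⧸ I • (⊤ : Submodule R N)) ⊆ Module.support R W := by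
    rw [Module.support_quotient, Module.support_eq_zeroLocus (M := W)]
    exact Set.inter_subset_right
  have hsmall := hE.isSerreSmall_lc (p := p)
    (fun i hi ↦ hE.lc_subsingleton hi _ (chainBound_of_coheight_le hpN hc.ge)) h d (by omega)
    (N ⧸ I • (⊤ : Submodule R N)) ((chainBound_of_height_le hp hh.ge).mono hsupp)
  exact hE.notMem_support_of_isSerreSmall
    ((hsmall.of_injective (hE.lcMap_mkQ_injective hd.le hI)).of_injective e.injective) hp

end CanonicalModule

theorem stmt3 (R : Type) [CommRing R] [IsNoetherianRing R] [IsLocalRing R]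
    (d' : ℕ) (M ω : ModuleCat R) (hM : Module.Finite R ↥M)
    (hdim : mdim R ↥M = (d' : WithBot ℕ∞))
    (hω : IsCanonicalModule R (maximalIdeal R) d' M ω) :
    (∀ a : Ideal R, htI R ↥M a ≤ htI R ↥ω a) ∧
    (∀ p ∈ Module.support R ↥ω, htM R ↥ω p = htM R ↥M p) := by
  obtain ⟨hfin, E, hE, ⟨e⟩⟩ := hω
  have hsub := hE.support_subset_of_dual e
  have hht : ∀ p ∈ Module.support R ↥ω, htM R ↥ω p = htM R ↥M p := fun p hp ↦ by
    rw [htM_eq_height hp, htM_eq_height (hsub hp), hE.height_eq_of_dual hdim e hp]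
  refine ⟨fun a ↦ sInf_le_sInf ?_, hht⟩
  rintro _ ⟨p, hp, hap, rfl⟩
  exact ⟨p, hsub hp, hap, hht p hp⟩
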